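/- arXiv:1008.2463 — 3 statements merged into one kernel-verified Lean document; each statement's English description precedes it below -/
import Mathlib

section
/- Let g = (g^{lk}) be a smooth family of complex n×n matrices on U satisfying the Jacobi identity, and let ψ : U → ℂ be smooth. Define h^{lk} := −Σ_{p,q} g^{lp}·(∂²ψ/∂z^p∂z̄^q)·g^{qk}. Then h = (h^{lk}) satisfies the linearized Jacobi identity with respect to g. -/
noncomputable section

open Complex

/-- Smooth-function carrier: complex-valued functions on `ℂⁿ`. -/
abbrev Cfn (n : ℕ) := (Fin n → ℂ) → ℂ

/-- The Wirtinger derivative `∂f/∂z^k := (1/2)(∂f/∂x^k − i·∂f/∂y^k)`. -/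
def wz {n : ℕ} (k : Fin n) (f : Cfn n) : Cfn n := fun x =>
  (1 / 2 : ℂ) * (fderiv ℝ f x (Pi.single k 1) - Complex.I * fderiv ℝ f x (Pi.single k Complex.I))

/-- The Wirtinger derivative `∂f/∂z̄^k := (1/2)(∂f/∂x^k + i·∂f/∂y^k)`. -/
def wzbar {n : ℕ} (k : Fin n) (f : Cfn n) : Cfn n := fun x =>
  (1 / 2 : ℂ) * (fderiv ℝ f x (Pi.single k 1) + Complex.I * fderiv ℝ f x (Pi.single k Complex.I))

/-- A smooth family of matrices `g = (g^{lk})` on `U` (first index antiholomorphic). -/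
def SmoothFamilyOn {n : ℕ} (U : Set (Fin n → ℂ)) (g : Fin n → Fin n → Cfn n) : Prop :=
  ∀ l k, ContDiffOn ℝ (⊤ : ℕ∞) (g l k) U

/-- The Jacobi identity for a family `g = (g^{lk})`, on `U`. -/
def JacobiOn {n : ℕ} (U : Set (Fin n → ℂ)) (g : Fin n → Fin n → Cfn n) : Prop :=
  (∀ l q p, ∀ x ∈ U, ∑ k, g l k x * wz k (g q p) x = ∑ k, g q k x * wz k (g l p) x) ∧
  (∀ k p q, ∀ x ∈ U, ∑ l, g l k x * wzbar l (g q p) x = ∑ l, g l p x * wzbar l (g q k) x)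

/-- The linearized Jacobi identity for `h` with respect to `g`, on `U`. -/
def LinJacobiOn {n : ℕ} (U : Set (Fin n → ℂ)) (g h : Fin n → Fin n → Cfn n) : Prop :=
  (∀ l q p, ∀ x ∈ U,
      ∑ k, (g l k x * wz k (h q p) x + h l k x * wz k (g q p) x) =
      ∑ k, (g q k x * wz k (h l p) x + h q k x * wz k (g l p) x)) ∧
  (∀ k p q, ∀ x ∈ U,
      ∑ l, (g l k x * wzbar l (h q p) x + h l k x * wzbar l (g q p) x) =
      ∑ l, (g l p x * wzbar l (h q k) x + h l p x * wzbar l (g q k) x))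

/-- The operator `D^k f := Σ_l g^{lk}·∂f/∂z̄^l`. -/
def Dop {n : ℕ} (g : Fin n → Fin n → Cfn n) (k : Fin n) (f : Cfn n) : Cfn n :=
  fun x => ∑ l, g l k x * wzbar l f x

/-- The operator `D̄^l f := Σ_k g^{lk}·∂f/∂z^k`. -/
def Dbarop {n : ℕ} (g : Fin n → Fin n → Cfn n) (l : Fin n) (f : Cfn n) : Cfn n :=
  fun x => ∑ k, g l k x * wz k f x

/-- `h^{lk} := −Σ_{p,q} g^{lp}·(∂²ψ/∂z^p∂z̄^q)·g^{qk}`. -/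
def hdef {n : ℕ} (g : Fin n → Fin n → Cfn n) (ψ : Cfn n) : Fin n → Fin n → Cfn n :=
  fun l k x => -∑ p, ∑ q, g l p x * wz p (wzbar q ψ) x * g q k x

end

/-- The general first order operator `½(∂/∂x^k + σ·∂/∂y^k)`, of which both Wirtinger derivatives
are instances. -/
noncomputable def dirDeriv {n : ℕ} (σ : ℂ) (k : Fin n) (f : Cfn n) : Cfn n := fun x =>
  (1 / 2 : ℂ) * (fderiv ℝ f x (Pi.single k 1) + σ * fderiv ℝ f x (Pi.single k Complex.I))

theorem wz_eq_dirDeriv {n : ℕ} (k : Fin n) (f : Cfn n) : wz k f = dirDeriv (-Complex.I) k f := by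
  funext x
  simp only [wz, dirDeriv]
  ring

theorem wzbar_eq_dirDeriv {n : ℕ} (k : Fin n) (f : Cfn n) :
    wzbar k f = dirDeriv Complex.I k f := rfl

theorem dirDeriv_mul {n : ℕ} (σ : ℂ) (k : Fin n) {f g : Cfn n} {x : Fin n → ℂ}
    (hf : DifferentiableAt ℝ f x) (hg : DifferentiableAt ℝ g x) :
    dirDeriv σ k (fun y => f y * g y) x = dirDeriv σ k f x * g x + f x * dirDeriv σ k g x := by
  simp only [dirDeriv, fderiv_fun_mul hf hg, add_apply,
    smul_apply, smul_eq_mul]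
  ring

theorem dirDeriv_neg {n : ℕ} (σ : ℂ) (k : Fin n) (f : Cfn n) (x : Fin n → ℂ) :
    dirDeriv σ k (fun y => -f y) x = -dirDeriv σ k f x := by
  simp only [dirDeriv, fderiv_fun_neg, neg_apply]
  ring

theorem dirDeriv_sum {n : ℕ} {ι : Type*} (s : Finset ι) (σ : ℂ) (k : Fin n) {f : ι → Cfn n}
    {x : Fin n → ℂ} (hf : ∀ i ∈ s, DifferentiableAt ℝ (f i) x) :
    dirDeriv σ k (fun y => ∑ i ∈ s, f i y) x = ∑ i ∈ s, dirDeriv σ k (f i) x := by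
  simp only [dirDeriv, fderiv_fun_sum hf, sum_apply, Finset.mul_sum,
    mul_add, Finset.sum_add_distrib]

theorem dirDeriv_congr {n : ℕ} (σ : ℂ) (k : Fin n) {f g : Cfn n} {U : Set (Fin n → ℂ)}
    (hU : IsOpen U) (hfg : Set.EqOn f g U) {x : Fin n → ℂ} (hx : x ∈ U) :
    dirDeriv σ k f x = dirDeriv σ k g x := by
  simp only [dirDeriv, (hfg.eventuallyEq_of_mem (hU.mem_nhds hx)).fderiv_eq]

theorem ContDiffOn.dirDeriv {n : ℕ} (σ : ℂ) (k : Fin n) {f : Cfn n} {U : Set (Fin n → ℂ)}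
    (hU : IsOpen U) (hf : ContDiffOn ℝ (⊤ : ℕ∞) f U) :
    ContDiffOn ℝ (⊤ : ℕ∞) (dirDeriv σ k f) U := by
  have h : ContDiffOn ℝ (⊤ : ℕ∞) (fderiv ℝ f) U := hf.fderiv_of_isOpen hU (by simp)
  exact contDiffOn_const.mul ((h.clm_apply contDiffOn_const).add
    (contDiffOn_const.mul (h.clm_apply contDiffOn_const)))

theorem ContDiffOn.differentiableAt_of_isOpen {n : ℕ} {f : Cfn n} {U : Set (Fin n → ℂ)}
    (hU : IsOpen U) (hf : ContDiffOn ℝ (⊤ : ℕ∞) f U) {x : Fin n → ℂ} (hx : x ∈ U) :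
    DifferentiableAt ℝ f x :=
  (hf.contDiffAt (hU.mem_nhds hx)).differentiableAt (by simp)

theorem dirDeriv_comm {n : ℕ} (σ τ : ℂ) (j k : Fin n) {f : Cfn n} {U : Set (Fin n → ℂ)}
    (hU : IsOpen U) (hf : ContDiffOn ℝ (⊤ : ℕ∞) f U) {x : Fin n → ℂ} (hx : x ∈ U) :
    dirDeriv σ j (dirDeriv τ k f) x = dirDeriv τ k (dirDeriv σ j f) x := by
  have hf' : ContDiffAt ℝ (⊤ : ℕ∞) f x := hf.contDiffAt (hU.mem_nhds hx)
  have hd : DifferentiableAt ℝ (fderiv ℝ f) x :=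
    (hf'.fderiv_right (m := 1) (WithTop.coe_le_coe.2 le_top)).differentiableAt (by simp)
  have hsymm : IsSymmSndFDerivAt ℝ f x :=
    hf'.isSymmSndFDerivAt (by
      simpa using WithTop.coe_le_coe.2 (le_top : (2 : ℕ∞) ≤ ⊤))
  have happ (v : Fin n → ℂ) : HasFDerivAt (fun y => fderiv ℝ f y v)
      ((fderiv ℝ (fderiv ℝ f) x).flip v) x := by
    simpa using hd.hasFDerivAt.clm_apply (hasFDerivAt_const v x)
  have hfd (ρ : ℂ) (i : Fin n) (w : Fin n → ℂ) : fderiv ℝ (dirDeriv ρ i f) x w =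
      (1 / 2 : ℂ) * (fderiv ℝ (fderiv ℝ f) x w (Pi.single i 1)
        + ρ * fderiv ℝ (fderiv ℝ f) x w (Pi.single i Complex.I)) := by
    have := (((happ (Pi.single i 1)).add
      ((happ (Pi.single i Complex.I)).const_mul ρ)).const_mul (1 / 2 : ℂ)).fderiv
    rw [show fderiv ℝ (dirDeriv ρ i f) x = _ from this]
    simp [mul_add]
  rw [dirDeriv, dirDeriv, hfd, hfd, hfd, hfd]
  rw [hsymm.eq (Pi.single j 1) (Pi.single k 1), hsymm.eq (Pi.single j 1) (Pi.single k Complex.I),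
    hsymm.eq (Pi.single j Complex.I) (Pi.single k 1),
    hsymm.eq (Pi.single j Complex.I) (Pi.single k Complex.I)]
  ring

theorem dirDeriv_hdef {n : ℕ} (σ : ℂ) (k : Fin n) {U : Set (Fin n → ℂ)} (hU : IsOpen U)
    {g : Fin n → Fin n → Cfn n} (hg : SmoothFamilyOn U g) {ψ : Cfn n}
    (hψ : ContDiffOn ℝ (⊤ : ℕ∞) ψ U) {x : Fin n → ℂ} (hx : x ∈ U) (l m : Fin n) :
    dirDeriv σ k (hdef g ψ l m) x = -∑ p, ∑ q,
      (dirDeriv σ k (g l p) x * wz p (wzbar q ψ) x * g q m x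
        + g l p x * dirDeriv σ k (wz p (wzbar q ψ)) x * g q m x
        + g l p x * wz p (wzbar q ψ) x * dirDeriv σ k (g q m) x) := by
  have hG (a b : Fin n) : DifferentiableAt ℝ (g a b) x := (hg a b).differentiableAt_of_isOpen hU hx
  have hP (p q : Fin n) : DifferentiableAt ℝ (wz p (wzbar q ψ)) x := by
    rw [wz_eq_dirDeriv, wzbar_eq_dirDeriv]
    exact ((hψ.dirDeriv _ q hU).dirDeriv _ p hU).differentiableAt_of_isOpen hU hx
  have hGP (p q : Fin n) := (hG l p).fun_mul (hP p q)
  have hGPG (p q : Fin n) := (hGP p q).fun_mul (hG q m)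
  unfold hdef
  rw [dirDeriv_neg, dirDeriv_sum _ _ _ fun p _ => DifferentiableAt.fun_sum fun q _ => hGPG p q]
  congr 1
  refine Finset.sum_congr rfl fun p _ => ?_
  rw [dirDeriv_sum _ _ _ fun q _ => hGPG p q]
  refine Finset.sum_congr rfl fun q _ => ?_
  rw [dirDeriv_mul _ _ (hGP p q) (hG q m), dirDeriv_mul _ _ (hG l p) (hP p q)]
  ring

/-- The pointwise algebra behind the linearized Jacobi identity: `G` is the value of a family at
a point, `dG k` its derivative in the `k`-th direction, `P` the mixed Hessian of the potential and
`dP k` the derivative of the latter. -/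
theorem jacobi_jet_symm {ι R : Type*} [Fintype ι] [CommRing R] (G P : ι → ι → R)
    (dG dP : ι → ι → ι → R) (hG : ∀ l q p, ∑ k, G l k * dG k q p = ∑ k, G q k * dG k l p)
    (hP : ∀ k a b, dP k a b = dP a k b) (l q p : ι) :
    ∑ k, (G l k * (-∑ a, ∑ b, (dG k q a * P a b * G b p + G q a * dP k a b * G b p
        + G q a * P a b * dG k b p)) + (-∑ a, ∑ b, G l a * P a b * G b k) * dG k q p) =
    ∑ k, (G q k * (-∑ a, ∑ b, (dG k l a * P a b * G b p + G l a * dP k a b * G b p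
        + G l a * P a b * dG k b p)) + (-∑ a, ∑ b, G q a * P a b * G b k) * dG k l p) := by
  have expand (l q : ι) :
      ∑ k, (G l k * (-∑ a, ∑ b, (dG k q a * P a b * G b p + G q a * dP k a b * G b p
        + G q a * P a b * dG k b p)) + (-∑ a, ∑ b, G l a * P a b * G b k) * dG k q p) =
      -(∑ a, ∑ b, (∑ k, G l k * dG k q a) * (P a b * G b p)
        + ∑ k, ∑ a, ∑ b, G l k * G q a * dP k a b * G b p
        + ∑ a, ∑ b, G q a * P a b * ∑ k, G l k * dG k b p
        + ∑ a, ∑ b, G l a * P a b * ∑ k, G b k * dG k q p) := by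
    have swap (F : ι → ι → ι → R) : ∑ a, ∑ b, ∑ k, F k a b = ∑ k, ∑ a, ∑ b, F k a b := by
      rw [Finset.sum_comm_cycle]
    simp only [Finset.sum_mul, Finset.mul_sum]
    rw [swap fun k a b => G l k * dG k q a * (P a b * G b p),
      swap fun k a b => G q a * P a b * (G l k * dG k b p),
      swap fun k a b => G l a * P a b * (G b k * dG k q p)]
    simp only [← Finset.sum_add_distrib, ← Finset.sum_neg_distrib, Finset.mul_sum, Finset.sum_mul]
    refine Finset.sum_congr rfl fun k _ => ?_
    refine Finset.sum_congr rfl fun a _ => ?_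
    refine Finset.sum_congr rfl fun b _ => ?_
    ring
  have hsymm : ∑ k, ∑ a, ∑ b, G l k * G q a * dP k a b * G b p =
      ∑ k, ∑ a, ∑ b, G q k * G l a * dP k a b * G b p := by
    rw [Finset.sum_comm]
    refine Finset.sum_congr rfl fun a _ => Finset.sum_congr rfl fun k _ =>
      Finset.sum_congr rfl fun b _ => ?_
    rw [hP k a b]
    ring
  rw [expand l q, expand q l, hsymm]
  simp only [hG l q, fun b => hG b q p, fun b => hG b l p]
  ring

/-- If `g` satisfies the Jacobi identity on `U` and `ψ : U → ℂ` is smooth,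
then `h^{lk} := −Σ_{p,q} g^{lp}·(∂²ψ/∂z^p∂z̄^q)·g^{qk}` satisfies the linearized Jacobi
identity with respect to `g` on `U`. -/
theorem hdef_linJacobi {n : ℕ} (U : Set (Fin n → ℂ)) (hU : IsOpen U)
    (g : Fin n → Fin n → Cfn n) (hg : SmoothFamilyOn U g) (hJ : JacobiOn U g)
    (ψ : Cfn n) (hψ : ContDiffOn ℝ (⊤ : ℕ∞) ψ U) :
    LinJacobiOn U g (hdef g ψ) := by
  have hz (k a b : Fin n) {x} (hx : x ∈ U) : dirDeriv (-Complex.I) k (wz a (wzbar b ψ)) x =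
      dirDeriv (-Complex.I) a (wz k (wzbar b ψ)) x := by
    simp only [wz_eq_dirDeriv, wzbar_eq_dirDeriv]
    exact dirDeriv_comm _ _ _ _ hU (hψ.dirDeriv _ b hU) hx
  have hzbar (k a b : Fin n) {x} (hx : x ∈ U) : dirDeriv Complex.I k (wz b (wzbar a ψ)) x =
      dirDeriv Complex.I a (wz b (wzbar k ψ)) x := by
    simp only [wz_eq_dirDeriv, wzbar_eq_dirDeriv]
    rw [dirDeriv_comm _ _ _ _ hU (hψ.dirDeriv _ a hU) hx,
      dirDeriv_comm _ _ _ _ hU (hψ.dirDeriv _ k hU) hx]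
    exact dirDeriv_congr _ _ hU (fun y hy => dirDeriv_comm _ _ _ _ hU hψ hy) hx
  refine ⟨fun l q p x hx => ?_, fun k p q x hx => ?_⟩
  · have key := jacobi_jet_symm (fun a b => g a b x) (fun a b => wz a (wzbar b ψ) x)
      (fun k a b => dirDeriv (-Complex.I) k (g a b) x)
      (fun k a b => dirDeriv (-Complex.I) k (wz a (wzbar b ψ)) x)
      (fun l q p => by simpa only [wz_eq_dirDeriv] using hJ.1 l q p x hx)
      (fun k a b => hz k a b hx) l q p
    simp only [wz_eq_dirDeriv _ (hdef _ _ _ _), wz_eq_dirDeriv _ (g _ _),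
      dirDeriv_hdef _ _ hU hg hψ hx]
    exact key
  · have key := jacobi_jet_symm (fun a b => g b a x) (fun a b => wz b (wzbar a ψ) x)
      (fun k a b => dirDeriv Complex.I k (g b a) x)
      (fun k a b => dirDeriv Complex.I k (wz b (wzbar a ψ)) x)
      (fun l q p => by simpa only [wzbar_eq_dirDeriv] using hJ.2 l q p x hx)
      (fun k a b => hzbar k a b hx) k p q
    simp only [wzbar_eq_dirDeriv _ (hdef _ _ _ _), wzbar_eq_dirDeriv _ (g _ _),
      dirDeriv_hdef _ _ hU hg hψ hx]
    unfold hdef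
    refine (Finset.sum_congr rfl fun m _ => ?_).trans
      (key.trans (Finset.sum_congr rfl fun m _ => ?_)) <;>
    · congr 2 <;>
        exact congrArg Neg.neg (Finset.sum_comm.trans (Finset.sum_congr rfl fun a _ =>
          Finset.sum_congr rfl fun b _ => by ring))
end

section
/- Let g = (g^{lk}) be a smooth family of complex n×n matrices on U satisfying the Jacobi identity, ψ : U → ℂ smooth, h^{lk} := −Σ_{p,q} g^{lp}·(∂²ψ/∂z^p∂z̄^q)·g^{qk}, and D^k f := Σ_l g^{lk}·∂f/∂z̄^l. Then for every k, the commutator of operators on C^∞(U,ℂ) satisfies [Σ_p (∂ψ/∂z^p)·D^p , D^k] = Σ_q h^{qk}·∂/∂z̄^q, i.e. for every smooth f : U → ℂ, Σ_p (∂ψ/∂z^p)·D^p(D^k f) − D^k(Σ_p (∂ψ/∂z^p)·D^p f) = Σ_q h^{qk}·∂f/∂z̄^q. -/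
section Wirtinger

variable {n : ℕ} {x : Fin n → ℂ} {f u v : Cfn n}

theorem wzbar_mul (m : Fin n) (hu : DifferentiableAt ℝ u x) (hv : DifferentiableAt ℝ v x) :
    wzbar m (fun y => u y * v y) x = u x * wzbar m v x + wzbar m u x * v x := by
  simp only [wzbar, fderiv_fun_mul hu hv, add_apply, smul_apply, smul_eq_mul]
  ring

theorem wzbar_sum {ι : Type*} (s : Finset ι) (m : Fin n) {F : ι → Cfn n}
    (hF : ∀ i ∈ s, DifferentiableAt ℝ (F i) x) :
    wzbar m (fun y => ∑ i ∈ s, F i y) x = ∑ i ∈ s, wzbar m (F i) x := by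
  simp only [wzbar, fderiv_fun_sum hF, sum_apply, Finset.mul_sum,
    ← Finset.sum_add_distrib]

theorem wzbar_sum_mul {ι : Type*} (s : Finset ι) (m : Fin n) {F G : ι → Cfn n}
    (hF : ∀ i ∈ s, DifferentiableAt ℝ (F i) x) (hG : ∀ i ∈ s, DifferentiableAt ℝ (G i) x) :
    wzbar m (fun y => ∑ i ∈ s, F i y * G i y) x =
      ∑ i ∈ s, (F i x * wzbar m (G i) x + wzbar m (F i) x * G i x) := by
  rw [wzbar_sum s m (F := fun i y => F i y * G i y) fun i hi => (hF i hi).mul (hG i hi)]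
  exact Finset.sum_congr rfl fun i hi => wzbar_mul m (hF i hi) (hG i hi)

theorem differentiableAt_fderiv_apply (hf : ContDiffAt ℝ 2 f x) (w : Fin n → ℂ) :
    DifferentiableAt ℝ (fun y => fderiv ℝ f y w) x :=
  ((hf.fderiv_right (m := 1) (by norm_num)).differentiableAt one_ne_zero).clm_apply
    (differentiableAt_const w)

theorem differentiableAt_wz (hf : ContDiffAt ℝ 2 f x) (k : Fin n) :
    DifferentiableAt ℝ (wz k f) x :=
  ((differentiableAt_fderiv_apply hf _).sub
    ((differentiableAt_fderiv_apply hf _).const_mul Complex.I)).const_mul _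

theorem differentiableAt_wzbar (hf : ContDiffAt ℝ 2 f x) (k : Fin n) :
    DifferentiableAt ℝ (wzbar k f) x :=
  ((differentiableAt_fderiv_apply hf _).add
    ((differentiableAt_fderiv_apply hf _).const_mul Complex.I)).const_mul _

theorem fderiv_fderiv_apply (hf : ContDiffAt ℝ 2 f x) (w e : Fin n → ℂ) :
    fderiv ℝ (fun y => fderiv ℝ f y w) x e = fderiv ℝ (fderiv ℝ f) x e w := by
  rw [fderiv_clm_apply ((hf.fderiv_right (m := 1) (by norm_num)).differentiableAt one_ne_zero)
    (differentiableAt_const w)]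
  simp

theorem fderiv_wz_apply (hf : ContDiffAt ℝ 2 f x) (k : Fin n) (e : Fin n → ℂ) :
    fderiv ℝ (wz k f) x e = (1 / 2 : ℂ) * (fderiv ℝ (fderiv ℝ f) x e (Pi.single k 1)
      - Complex.I * fderiv ℝ (fderiv ℝ f) x e (Pi.single k Complex.I)) := by
  have h₁ := differentiableAt_fderiv_apply hf (Pi.single k 1)
  have h₂ := differentiableAt_fderiv_apply hf (Pi.single k Complex.I)
  unfold wz
  rw [fderiv_const_mul (h₁.fun_sub (h₂.const_mul _)), fderiv_fun_sub h₁ (h₂.const_mul _),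
    fderiv_const_mul h₂]
  simp [fderiv_fderiv_apply hf]

theorem fderiv_wzbar_apply (hf : ContDiffAt ℝ 2 f x) (k : Fin n) (e : Fin n → ℂ) :
    fderiv ℝ (wzbar k f) x e = (1 / 2 : ℂ) * (fderiv ℝ (fderiv ℝ f) x e (Pi.single k 1)
      + Complex.I * fderiv ℝ (fderiv ℝ f) x e (Pi.single k Complex.I)) := by
  have h₁ := differentiableAt_fderiv_apply hf (Pi.single k 1)
  have h₂ := differentiableAt_fderiv_apply hf (Pi.single k Complex.I)
  unfold wzbar
  rw [fderiv_const_mul (h₁.fun_add (h₂.const_mul _)), fderiv_fun_add h₁ (h₂.const_mul _),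
    fderiv_const_mul h₂]
  simp [fderiv_fderiv_apply hf, mul_add]

theorem wzbar_comm (hf : ContDiffAt ℝ 2 f x) (k l : Fin n) :
    wzbar k (wzbar l f) x = wzbar l (wzbar k f) x := by
  have hs := hf.isSymmSndFDerivAt (by simp)
  simp only [wzbar.eq_1 _ (wzbar _ f), fderiv_wzbar_apply hf]
  rw [hs (Pi.single k 1) (Pi.single l 1), hs (Pi.single k 1) (Pi.single l Complex.I),
    hs (Pi.single k Complex.I) (Pi.single l 1), hs (Pi.single k Complex.I) (Pi.single l Complex.I)]
  ring

theorem wzbar_wz_comm (hf : ContDiffAt ℝ 2 f x) (k l : Fin n) :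
    wzbar k (wz l f) x = wz l (wzbar k f) x := by
  have hs := hf.isSymmSndFDerivAt (by simp)
  rw [wzbar, wz]
  simp only [fderiv_wzbar_apply hf, fderiv_wz_apply hf]
  rw [hs (Pi.single k 1) (Pi.single l 1), hs (Pi.single k 1) (Pi.single l Complex.I),
    hs (Pi.single k Complex.I) (Pi.single l 1), hs (Pi.single k Complex.I) (Pi.single l Complex.I)]
  ring

variable {g : Fin n → Fin n → Cfn n}

theorem differentiableAt_Dop (hg : ∀ l k, DifferentiableAt ℝ (g l k) x)
    (hf : ContDiffAt ℝ 2 f x) (k : Fin n) : DifferentiableAt ℝ (Dop g k f) x :=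
  DifferentiableAt.fun_sum fun l _ => (hg l k).mul (differentiableAt_wzbar hf l)

theorem Dop_Dop (hg : ∀ l k, DifferentiableAt ℝ (g l k) x) (hf : ContDiffAt ℝ 2 f x)
    (p k : Fin n) :
    Dop g p (Dop g k f) x = (∑ m, ∑ l, g m p x * g l k x * wzbar m (wzbar l f) x)
      + ∑ l, (∑ m, g m p x * wzbar m (g l k) x) * wzbar l f x := by
  have h (m : Fin n) : wzbar m (Dop g k f) x =
      ∑ l, (g l k x * wzbar m (wzbar l f) x + wzbar m (g l k) x * wzbar l f x) :=
    wzbar_sum_mul _ m (fun l _ => hg l k) fun l _ => differentiableAt_wzbar hf l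
  rw [Dop]
  simp only [h, Finset.mul_sum, mul_add, Finset.sum_add_distrib, Finset.sum_mul, mul_assoc]
  congr 1
  exact Finset.sum_comm

/-- The Jacobi identity makes the operators `D^p` commute. -/
theorem Dop_comm (hg : ∀ l k, DifferentiableAt ℝ (g l k) x) (hf : ContDiffAt ℝ 2 f x)
    (hJ : ∀ k p q, ∑ l, g l k x * wzbar l (g q p) x = ∑ l, g l p x * wzbar l (g q k) x)
    (p k : Fin n) : Dop g p (Dop g k f) x = Dop g k (Dop g p f) x := by
  rw [Dop_Dop hg hf, Dop_Dop hg hf, Finset.sum_comm]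
  simp only [hJ p k, wzbar_comm hf, mul_comm (g _ p x) (g _ k x)]

/-- `D^k` is a derivation. -/
theorem Dop_sum_mul {ι : Type*} (s : Finset ι) {F G : ι → Cfn n}
    (hF : ∀ i ∈ s, DifferentiableAt ℝ (F i) x) (hG : ∀ i ∈ s, DifferentiableAt ℝ (G i) x)
    (k : Fin n) :
    Dop g k (fun y => ∑ i ∈ s, F i y * G i y) x =
      ∑ i ∈ s, (F i x * Dop g k (G i) x + Dop g k (F i) x * G i x) := by
  simp only [Dop, wzbar_sum_mul s _ hF hG, Finset.mul_sum, Finset.sum_mul,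
    ← Finset.sum_add_distrib]
  rw [Finset.sum_comm]
  exact Finset.sum_congr rfl fun i _ => Finset.sum_congr rfl fun l _ => by ring

end Wirtinger

/-- With `g` Jacobi, `ψ` smooth, `h^{lk} := −Σ_{p,q} g^{lp}(∂²ψ/∂z^p∂z̄^q)g^{qk}`
and `D^k f := Σ_l g^{lk} ∂f/∂z̄^l`, for every `k` the commutator
`[Σ_p (∂ψ/∂z^p)·D^p , D^k]` equals `Σ_q h^{qk}·∂/∂z̄^q` on `C^∞(U,ℂ)`. -/
theorem commutator_eq_hdef {n : ℕ} (U : Set (Fin n → ℂ)) (hU : IsOpen U)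
    (g : Fin n → Fin n → Cfn n) (hg : SmoothFamilyOn U g) (hJ : JacobiOn U g)
    (ψ : Cfn n) (hψ : ContDiffOn ℝ (⊤ : ℕ∞) ψ U) :
    ∀ k, ∀ f : Cfn n, ContDiffOn ℝ (⊤ : ℕ∞) f U → ∀ x ∈ U,
      (∑ p, wz p ψ x * Dop g p (Dop g k f) x)
        - Dop g k (fun y => ∑ p, wz p ψ y * Dop g p f y) x
      = ∑ q, hdef g ψ q k x * wzbar q f x := by
  intro k f hf x hx
  have smooth {u : Cfn n} (hu : ContDiffOn ℝ (⊤ : ℕ∞) u U) : ContDiffAt ℝ 2 u x :=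
    (hu.contDiffAt (hU.mem_nhds hx)).of_le (WithTop.coe_le_coe.2 le_top)
  have hf₂ := smooth hf
  have hψ₂ := smooth hψ
  have hg₁ (l k) : DifferentiableAt ℝ (g l k) x := (smooth (hg l k)).differentiableAt two_ne_zero
  rw [Dop_sum_mul _ (fun p _ => differentiableAt_wz hψ₂ p)
    (fun p _ => differentiableAt_Dop hg₁ hf₂ p), ← Finset.sum_sub_distrib]
  have hcomm (p : Fin n) : Dop g p (Dop g k f) x = Dop g k (Dop g p f) x :=
    Dop_comm hg₁ hf₂ (fun k p q => hJ.2 k p q x hx) p k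
  simp only [hcomm, sub_add_cancel_left]
  simp only [hdef, Dop, wzbar_wz_comm hψ₂, neg_mul,
    Finset.sum_neg_distrib, Finset.sum_mul, Finset.mul_sum]
  congr 1
  conv_rhs => rw [Finset.sum_comm]
  exact Finset.sum_congr rfl fun p _ => Finset.sum_congr rfl fun q _ =>
    Finset.sum_congr rfl fun l _ => by ring
end

section
/- Let ∗ and ∗̃ be natural differential star products on (U, π₀) such that σ(L_f) = σ(L̃_f) =: S₀f and σ(R_f) = σ(R̃_f) =: T₀f for every f ∈ C^∞(U). Define S₁f := σ((1/ν)(L_f − L̃_f)) and T₁f := σ((1/ν)(R_f − R̃_f)) (well defined since L_f − L̃_f and R_f − R̃_f lie in ν times the natural operators), define {f,g}₁ := (C₂(f,g) − C₂(g,f)) − (C̃₂(f,g) − C̃₂(g,f)), and let E denote evaluation of fiberwise-polynomial formal series on T*U at the zero section (setting the fiber variables to 0). Then for all f, g ∈ C^∞(U): (i) E(S₁f) = 0 and E(T₁f) = 0; (ii) S₁(fg) = S₀f·S₁g + S₁f·S₀g and T₁(fg) = T₀f·T₁g + T₁f·T₀g; (iii) S₁({f,g}₀) + S₀({f,g}₁)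 = {S₀f, S₁g}_{T*U} + {S₁f, S₀g}_{T*U}, T₁({f,g}₀) + T₀({f,g}₁) = −{T₀f, T₁g}_{T*U} − {T₁f, T₀g}_{T*U}, and {S₀f, T₁g}_{T*U} + {S₁f, T₀g}_{T*U} = 0, where {·,·}_{T*U} is the canonical Poisson bracket of the cotangent bundle T*U = U × ℝ^d. -/
noncomputable section

/-- Real-valued functions on `ℝ^d`. -/
abbrev Rfn (d : ℕ) := (Fin d → ℝ) → ℝ

/-- The partial derivative `∂/∂x^i`. -/
def pderi {d : ℕ} (i : Fin d) (f : Rfn d) : Rfn d := fun x => fderiv ℝ f x (Pi.single i 1)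

/-- Iterated partial derivative `∂^α`, indexed by a list of coordinate directions. -/
def pderL {d : ℕ} (L : List (Fin d)) (f : Rfn d) : Rfn d := L.foldr pderi f

/-- `B` is a bidifferential operator on `U` of order at most `N` in each argument:
a finite sum `(f,g) ↦ Σ_{α,β} a^{αβ}·∂^α f·∂^β g` with smooth coefficients. -/
def IsBidiffOpOn {d : ℕ} (U : Set (Fin d → ℝ)) (N : ℕ) (B : Rfn d → Rfn d → Rfn d) : Prop :=
  ∃ (s : Finset (List (Fin d) × List (Fin d))) (a : List (Fin d) × List (Fin d) → Rfn d),
    (∀ p ∈ s, p.1.length ≤ N ∧ p.2.length ≤ N) ∧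
    (∀ p, ContDiffOn ℝ (⊤ : ℕ∞) (a p) U) ∧
    (∀ f g : Rfn d, ∀ x ∈ U, B f g x = ∑ p ∈ s, a p x * pderL p.1 f x * pderL p.2 g x)

/-- The bracket `{f,g} = Σ_{i,j} π^{ij}·∂_i f·∂_j g` of a bivector field `π`. -/
def pbr {d : ℕ} (π : Fin d → Fin d → Rfn d) (f g : Rfn d) : Rfn d :=
  fun x => ∑ i, ∑ j, π i j x * pderi i f x * pderi j g x

/-- `π₀` is a smooth Poisson bivector field on `U`. -/
def IsPoissonOn {d : ℕ} (U : Set (Fin d → ℝ)) (π₀ : Fin d → Fin d → Rfn d) : Prop :=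
  (∀ i j, ContDiffOn ℝ (⊤ : ℕ∞) (π₀ i j) U) ∧
  (∀ i j, ∀ x ∈ U, π₀ i j x = -π₀ j i x) ∧
  (∀ f g h : Rfn d, ContDiffOn ℝ (⊤ : ℕ∞) f U → ContDiffOn ℝ (⊤ : ℕ∞) g U → ContDiffOn ℝ (⊤ : ℕ∞) h U →
    ∀ x ∈ U, pbr π₀ (pbr π₀ f g) h x + pbr π₀ (pbr π₀ g h) f x + pbr π₀ (pbr π₀ h f) g x = 0)

/-- A natural differential star product `f∗g = Σ_r ν^r·C_r(f,g)` on `(U, π₀)`: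
`C₀(f,g) = fg`, `C₁(f,g) − C₁(g,f) = {f,g}₀`, `1` is a unit, the product is associative
(order by order in `ν`), and `C_r` is a bidifferential operator of order at most `r` in
each argument. -/
structure NatStar (d : ℕ) (U : Set (Fin d → ℝ)) (π₀ : Fin d → Fin d → Rfn d) where
  C : ℕ → Rfn d → Rfn d → Rfn d
  natural : ∀ r, IsBidiffOpOn U r (C r)
  C_zero : ∀ f g : Rfn d, ∀ x ∈ U, C 0 f g x = f x * g x
  C_one_skew : ∀ f g : Rfn d, ContDiffOn ℝ (⊤ : ℕ∞) f U → ContDiffOn ℝ (⊤ : ℕ∞) g U →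
    ∀ x ∈ U, C 1 f g x - C 1 g f x = pbr π₀ f g x
  one_left : ∀ r, 0 < r → ∀ f : Rfn d, ContDiffOn ℝ (⊤ : ℕ∞) f U →
    ∀ x ∈ U, C r (fun _ => 1) f x = 0
  one_right : ∀ r, 0 < r → ∀ f : Rfn d, ContDiffOn ℝ (⊤ : ℕ∞) f U →
    ∀ x ∈ U, C r f (fun _ => 1) x = 0
  assoc : ∀ (r : ℕ) (f g h : Rfn d),
    ContDiffOn ℝ (⊤ : ℕ∞) f U → ContDiffOn ℝ (⊤ : ℕ∞) g U → ContDiffOn ℝ (⊤ : ℕ∞) h U → ∀ x ∈ U,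
    ∑ i ∈ Finset.range (r + 1), C i (C (r - i) f g) h x
      = ∑ i ∈ Finset.range (r + 1), C i f (C (r - i) g h) x

/-- The principal symbol of order `r` of an operator `A` of order at most `r`, as a
function on `T*U = U × ℝ^d`:
`σ_r(A)(x,ξ) = (1/r!)·A((y ↦ ⟨y − x, ξ⟩^r))(x)`. -/
def symb {d : ℕ} (r : ℕ) (A : Rfn d → Rfn d) : ((Fin d → ℝ) × (Fin d → ℝ)) → ℝ :=
  fun p => (r.factorial : ℝ)⁻¹ * A (fun y => (∑ i, p.2 i * (y i - p.1 i)) ^ r) p.1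

end

noncomputable section

/-- Formal series of fiberwise-polynomial functions on `T*U = U × ℝ^d`, graded by the
fiber degree `r`. -/
abbrev SymSer (d : ℕ) := ℕ → ((Fin d → ℝ) × (Fin d → ℝ)) → ℝ

/-- `S₀f = σ(L_f)`, componentwise `σ_r(C_r(f,·))`. -/
def S0 {d : ℕ} {U : Set (Fin d → ℝ)} {π₀ : Fin d → Fin d → Rfn d}
    (SP : NatStar d U π₀) (f : Rfn d) : SymSer d :=
  fun r => symb r (fun u => SP.C r f u)

/-- `T₀f = σ(R_f)`, componentwise `σ_r(C_r(·,f))`. -/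
def T0 {d : ℕ} {U : Set (Fin d → ℝ)} {π₀ : Fin d → Fin d → Rfn d}
    (SP : NatStar d U π₀) (f : Rfn d) : SymSer d :=
  fun r => symb r (fun u => SP.C r u f)

/-- `S₁f = σ((1/ν)(L_f − L̃_f))`, componentwise `σ_r(C_{r+1}(f,·) − C̃_{r+1}(f,·))`. -/
def S1 {d : ℕ} {U : Set (Fin d → ℝ)} {π₀ : Fin d → Fin d → Rfn d}
    (SP SP' : NatStar d U π₀) (f : Rfn d) : SymSer d :=
  fun r => symb r (fun u => SP.C (r + 1) f u - SP'.C (r + 1) f u)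

/-- `T₁f = σ((1/ν)(R_f − R̃_f))`, componentwise `σ_r(C_{r+1}(·,f) − C̃_{r+1}(·,f))`. -/
def T1 {d : ℕ} {U : Set (Fin d → ℝ)} {π₀ : Fin d → Fin d → Rfn d}
    (SP SP' : NatStar d U π₀) (f : Rfn d) : SymSer d :=
  fun r => symb r (fun u => SP.C (r + 1) u f - SP'.C (r + 1) u f)

/-- Product of formal series of fiberwise polynomials. -/
def mulSer {d : ℕ} (P Q : SymSer d) : SymSer d :=
  fun r p => ∑ i ∈ Finset.range (r + 1), P i p * Q (r - i) p

/-- The canonical Poisson bracket of two functions on `T*U = U × ℝ^d`: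
`{F,G} = Σ_i (∂F/∂ξ_i·∂G/∂x_i − ∂F/∂x_i·∂G/∂ξ_i)`. -/
def pbT {d : ℕ} (F G : ((Fin d → ℝ) × (Fin d → ℝ)) → ℝ) :
    ((Fin d → ℝ) × (Fin d → ℝ)) → ℝ :=
  fun p => ∑ i,
    (fderiv ℝ F p (0, Pi.single i 1) * fderiv ℝ G p (Pi.single i 1, 0)
      - fderiv ℝ F p (Pi.single i 1, 0) * fderiv ℝ G p (0, Pi.single i 1))

/-- The canonical Poisson bracket of formal series of fiberwise polynomials: the
component of fiber degree `r` is `Σ_{i+j=r+1} {P_i, Q_j}`. -/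
def pbTSer {d : ℕ} (P Q : SymSer d) : SymSer d :=
  fun r p => ∑ i ∈ Finset.range (r + 2), pbT (P i) (Q (r + 1 - i)) p

/-- Equality of symbol series over `U`. -/
def EqSer {d : ℕ} (U : Set (Fin d → ℝ)) (P Q : SymSer d) : Prop :=
  ∀ r : ℕ, ∀ x ∈ U, ∀ ξ : Fin d → ℝ, P r (x, ξ) = Q r (x, ξ)

/-- The bidifferential operator `{f,g}₁ := (C₂(f,g) − C₂(g,f)) − (C̃₂(f,g) − C̃₂(g,f))`. -/
def brOne {d : ℕ} {U : Set (Fin d → ℝ)} {π₀ : Fin d → Fin d → Rfn d}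
    (SP SP' : NatStar d U π₀) (f g : Rfn d) : Rfn d :=
  fun x => (SP.C 2 f g x - SP.C 2 g f x) - (SP'.C 2 f g x - SP'.C 2 g f x)

/-- Multiplication operators. -/
def mop (R : Type*) [CommRing R] [Algebra ℝ R] : R →ₗ[ℝ] Module.End ℝ R := LinearMap.mul ℝ R

/-- Commutator `A ↦ A ∘ m − m ∘ A` with the multiplication operator by `m`. -/
def adMul (R : Type*) [CommRing R] [Algebra ℝ R] :
    R →ₗ[ℝ] Module.End ℝ (Module.End ℝ R) :=
  LinearMap.mk₂ ℝ (fun m A => A * mop R m - mop R m * A)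
    (fun m n A => by simp only [map_add, mul_add, add_mul]; abel)
    (fun c m A => by simp only [map_smul, mul_smul_comm, smul_mul_assoc, smul_sub])
    (fun m A B => by simp only [mul_add, add_mul]; abel)
    (fun c m A => by simp only [mul_smul_comm, smul_mul_assoc, smul_sub])

section
variable {R : Type*} [CommRing R] [Algebra ℝ R]

@[simp] theorem mop_apply (m u : R) : mop R m u = m * u := rfl

@[simp] theorem mop_one : mop R 1 = 1 := by ext; simp

theorem adMul_apply (m : R) (A : Module.End ℝ R) :
    adMul R m A = A * mop R m - mop R m * A := rfl

@[simp] theorem adMul_apply_apply (m : R) (A : Module.End ℝ R) (u : R) :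
    adMul R m A u = A (m * u) - m * A u := rfl

theorem adMul_mul (m : R) (A B : Module.End ℝ R) :
    adMul R m (A * B) = adMul R m A * B + A * adMul R m B := by
  simp only [adMul_apply, sub_mul, mul_sub, mul_assoc]; abel

theorem adMul_commute (m n : R) : Commute (adMul R m) (adMul R n) := by
  ext A u
  simp only [Module.End.mul_apply, adMul_apply_apply, mul_left_comm n m]
  ring

theorem adMul_sub_algebraMap (m : R) (c : ℝ) : adMul R (m - algebraMap ℝ R c) = adMul R m := by
  ext A u
  simp [Algebra.algebraMap_eq_smul_one]

theorem adMul_lmul (m a : R) : adMul R m (mop R a) = 0 := by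
  ext u
  simp [mul_left_comm]

end

/-- A commutative `ℝ`-algebra with coordinates `x i` and commuting derivations `∂ i` dual to
them. -/
structure CoordAlg (d : ℕ) (R : Type*) [CommRing R] [Algebra ℝ R] where
  der : Fin d → Derivation ℝ R R
  x : Fin d → R
  comm : ∀ i j u, der i (der j u) = der j (der i u)
  dual : ∀ i j, der i (x j) = if i = j then 1 else 0

namespace CoordAlg

open Finset.HasAntidiagonal (antidiagonal mem_antidiagonal)

variable {d : ℕ} {R : Type*} [CommRing R] [Algebra ℝ R] (X : CoordAlg d R)

/-- The derivation `∂ i` as a linear operator. -/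
def op (i : Fin d) : Module.End ℝ R := (X.der i : R →ₗ[ℝ] R)

@[simp] theorem op_apply (i : Fin d) (u : R) : X.op i u = X.der i u := rfl

theorem op_comm (i j : Fin d) : X.op i * X.op j = X.op j * X.op i := by
  ext u; exact X.comm i j u

/-- The linear coordinate function with coefficients `ξ`. -/
def lin : (Fin d → ℝ) →ₗ[ℝ] R := Fintype.linearCombination ℝ X.x

theorem lin_apply (ξ : Fin d → ℝ) : X.lin ξ = ∑ i, ξ i • X.x i := rfl

/-- Commutator with the linear function `ξ`. -/
def ad : (Fin d → ℝ) →ₗ[ℝ] Module.End ℝ (Module.End ℝ R) := adMul R ∘ₗ X.lin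

theorem ad_apply (ξ : Fin d → ℝ) : X.ad ξ = adMul R (X.lin ξ) := rfl

theorem ad_mul (ξ : Fin d → ℝ) (A B : Module.End ℝ R) :
    X.ad ξ (A * B) = X.ad ξ A * B + A * X.ad ξ B := adMul_mul _ _ _

theorem ad_commute (ξ η : Fin d → ℝ) : Commute (X.ad ξ) (X.ad η) := adMul_commute _ _

theorem ad_lmul (ξ : Fin d → ℝ) (a : R) : X.ad ξ (mop R a) = 0 := adMul_lmul _ _

theorem der_lin (i : Fin d) (ξ : Fin d → ℝ) : X.der i (X.lin ξ) = algebraMap ℝ R (ξ i) := by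
  simp [lin_apply, X.dual, Algebra.algebraMap_eq_smul_one]

theorem ad_op (ξ : Fin d → ℝ) (i : Fin d) : X.ad ξ (X.op i) = ξ i • 1 := by
  ext u
  simp [ad_apply, der_lin, Algebra.smul_def, mul_comm]

theorem ad_eq_sum (ξ : Fin d → ℝ) : X.ad ξ = ∑ i, ξ i • X.ad (Pi.single i 1) := by
  conv_lhs => rw [pi_eq_sum_univ' ξ]
  simp only [map_sum, map_smul]

/-- The constant coefficient operator `∂^L`. -/
def word (L : List (Fin d)) : Module.End ℝ R := (L.map X.op).prod

/-- Linear span of the operators `a ∂^L`. -/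
def diffOps : Submodule ℝ (Module.End ℝ R) :=
  Submodule.span ℝ {A | ∃ a L, A = mop R a * X.word L}

theorem lmul_mul_word_mem (a : R) (L : List (Fin d)) :
    mop R a * X.word L ∈ X.diffOps := Submodule.subset_span ⟨a, L, rfl⟩

theorem word_concat (L : List (Fin d)) (j : Fin d) : X.word (L ++ [j]) = X.word L * X.op j := by
  simp [word]

theorem mul_op_mem {A : Module.End ℝ R} (hA : A ∈ X.diffOps) (j : Fin d) :
    A * X.op j ∈ X.diffOps := by
  induction hA using Submodule.span_induction with
  | mem A h =>
    obtain ⟨a, L, rfl⟩ := h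
    rw [mul_assoc, ← word_concat]
    exact X.lmul_mul_word_mem _ _
  | zero => simp
  | add A B _ _ hA hB => rw [add_mul]; exact add_mem hA hB
  | smul c A _ hA => rw [smul_mul_assoc]; exact Submodule.smul_mem _ _ hA

theorem ad_mem {A : Module.End ℝ R} (hA : A ∈ X.diffOps) (ξ : Fin d → ℝ) :
    X.ad ξ A ∈ X.diffOps := by
  induction hA using Submodule.span_induction with
  | mem A h =>
    obtain ⟨a, L, rfl⟩ := h
    induction L using List.reverseRecOn with
    | nil => simp [word, ad_lmul]
    | append_singleton L j ih =>
      rw [word_concat, ← mul_assoc, ad_mul, ad_op]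
      refine add_mem (X.mul_op_mem ih j) ?_
      rw [mul_smul_comm, mul_one]
      exact Submodule.smul_mem _ _ (X.lmul_mul_word_mem _ _)
  | zero => simp
  | add A B _ _ hA hB => rw [map_add]; exact add_mem hA hB
  | smul c A _ hA => rw [map_smul]; exact Submodule.smul_mem _ _ hA

/-- The operator `A ↦ Σ_i [A, x_i] ∂_i`, which counts the number of derivatives. -/
def euler : Module.End ℝ (Module.End ℝ R) :=
  ∑ i, LinearMap.mulRight ℝ (X.op i) * X.ad (Pi.single i 1)

theorem euler_apply (A : Module.End ℝ R) :
    X.euler A = ∑ i, X.ad (Pi.single i 1) A * X.op i := by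
  simp [euler]

theorem euler_mul_op (A : Module.End ℝ R) (j : Fin d) :
    X.euler (A * X.op j) = X.euler A * X.op j + A * X.op j := by
  simp only [euler_apply, ad_mul, ad_op, add_mul, Finset.sum_add_distrib, Finset.sum_mul]
  congr 1
  · exact Finset.sum_congr rfl fun i _ => by rw [mul_assoc, X.op_comm, mul_assoc]
  · rw [Finset.sum_eq_single j] <;> simp +contextual [eq_comm]

theorem euler_lmul_mul_word (a : R) (L : List (Fin d)) :
    X.euler (mop R a * X.word L) =
      (L.length : ℝ) • (mop R a * X.word L) := by
  induction L using List.reverseRecOn with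
  | nil => simp [word, euler_apply, ad_lmul]
  | append_singleton L j ih =>
    rw [word_concat, ← mul_assoc, euler_mul_op, ih]
    simp [add_smul]

theorem exists_sub_lmul_mem {A : Module.End ℝ R} (hA : A ∈ X.diffOps) :
    ∃ a, A - mop R a ∈ ⨆ k : ℝ, ⨆ _ : k ≠ 0, X.euler.eigenspace k := by
  induction hA using Submodule.span_induction with
  | mem A h =>
    obtain ⟨a, L, rfl⟩ := h
    rcases L.eq_nil_or_concat' with rfl | ⟨L, j, rfl⟩
    · exact ⟨a, by simp [word]⟩
    · refine ⟨0, ?_⟩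
      rw [map_zero, sub_zero]
      refine Submodule.mem_iSup_of_mem ((L ++ [j]).length : ℝ) (Submodule.mem_iSup_of_mem ?_ ?_)
      · simp only [List.length_append, List.length_singleton]; positivity
      · rw [Module.End.mem_eigenspace_iff]
        exact X.euler_lmul_mul_word _ _
  | zero => exact ⟨0, by simp⟩
  | add A B _ _ hA hB =>
    obtain ⟨a, ha⟩ := hA
    obtain ⟨b, hb⟩ := hB
    refine ⟨a + b, ?_⟩
    rw [map_add, add_sub_add_comm]
    exact add_mem ha hb
  | smul c A _ hA =>
    obtain ⟨a, ha⟩ := hA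
    refine ⟨c • a, ?_⟩
    rw [map_smul, ← smul_sub]
    exact Submodule.smul_mem _ _ ha

/-- A differential operator commuting with the coordinates is a multiplication operator. -/
theorem eq_lmul_of_ad_eq_zero {A : Module.End ℝ R} (hA : A ∈ X.diffOps)
    (h : ∀ i, X.ad (Pi.single i 1) A = 0) : A = mop R (A 1) := by
  obtain ⟨a, ha⟩ := X.exists_sub_lmul_mem hA
  have h0 : A - mop R a ∈ X.euler.eigenspace 0 := by
    rw [Module.End.mem_eigenspace_iff]
    simp [euler_apply, h, ad_lmul]
  have := Submodule.disjoint_def.1 (Module.End.eigenspaces_iSupIndep X.euler 0) _ h0 ha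
  rw [sub_eq_zero] at this
  subst this
  simp

/-- `A` is a differential operator of order at most `n`. -/
def Ord (n : ℕ) (A : Module.End ℝ R) : Prop :=
  A ∈ X.diffOps ∧ ∀ ξ, (X.ad ξ ^ (n + 1)) A = 0

theorem ad_pow_mul_op (ξ : Fin d → ℝ) (j : Fin d) (m : ℕ) (A : Module.End ℝ R)
    (h : (X.ad ξ ^ m) A = 0) : (X.ad ξ ^ (m + 1)) (A * X.op j) = 0 := by
  induction m generalizing A with
  | zero => simp_all
  | succ m ih =>
    have h' : (X.ad ξ ^ m) (X.ad ξ A) = 0 := by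
      rw [← Module.End.mul_apply, ← pow_succ, h]
    rw [pow_succ, Module.End.mul_apply, ad_mul, ad_op, map_add, ih _ h', mul_smul_comm,
      mul_one, map_smul, h, smul_zero, add_zero]

theorem ad_pow_eq_zero_of_le {ξ : Fin d → ℝ} {m n : ℕ} (hmn : m ≤ n) {A : Module.End ℝ R}
    (h : (X.ad ξ ^ m) A = 0) : (X.ad ξ ^ n) A = 0 := by
  obtain ⟨k, rfl⟩ := Nat.exists_eq_add_of_le' hmn
  rw [pow_add, Module.End.mul_apply, h, map_zero]

variable {X}

theorem ord_lmul_mul_word (a : R) (L : List (Fin d)) :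
    X.Ord L.length (mop R a * X.word L) := by
  refine ⟨X.lmul_mul_word_mem a L, fun ξ => ?_⟩
  induction L using List.reverseRecOn with
  | nil => simp [word, ad_lmul]
  | append_singleton L j ih =>
    rw [word_concat, ← mul_assoc, List.length_append]
    exact X.ad_pow_mul_op ξ j _ _ ih

theorem Ord.mono {m n : ℕ} (hmn : m ≤ n) {A : Module.End ℝ R} (h : X.Ord m A) : X.Ord n A :=
  ⟨h.1, fun ξ => X.ad_pow_eq_zero_of_le (by omega) (h.2 ξ)⟩

theorem Ord.add {n : ℕ} {A B : Module.End ℝ R} (hA : X.Ord n A) (hB : X.Ord n B) :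
    X.Ord n (A + B) :=
  ⟨add_mem hA.1 hB.1, fun ξ => by rw [map_add, hA.2, hB.2, add_zero]⟩

theorem Ord.sub {n : ℕ} {A B : Module.End ℝ R} (hA : X.Ord n A) (hB : X.Ord n B) :
    X.Ord n (A - B) :=
  ⟨sub_mem hA.1 hB.1, fun ξ => by rw [map_sub, hA.2, hB.2, sub_zero]⟩

theorem Ord.sum {ι : Type*} {n : ℕ} (s : Finset ι) {A : ι → Module.End ℝ R}
    (h : ∀ i ∈ s, X.Ord n (A i)) : X.Ord n (∑ i ∈ s, A i) :=
  ⟨sum_mem fun i hi => (h i hi).1, fun ξ => by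
    rw [map_sum]; exact Finset.sum_eq_zero fun i hi => (h i hi).2 ξ⟩

theorem eq_zero_of_forall_sum_pow_smul {V : Type*} [AddCommGroup V] [Module ℝ V] {n : ℕ}
    (v : ℕ → V) (h : ∀ t : ℝ, ∑ k ∈ Finset.range n, t ^ k • v k = 0) {k : ℕ} (hk : k < n) :
    v k = 0 := by
  rw [← Module.forall_dual_apply_eq_zero_iff ℝ]
  intro φ
  have hp : (∑ k ∈ Finset.range n, Polynomial.C (φ (v k)) * Polynomial.X ^ k) = 0 := by
    apply Polynomial.funext
    intro t
    have := congrArg φ (h t)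
    simp only [map_sum, map_smul, smul_eq_mul, map_zero] at this
    simp only [Polynomial.eval_finsetSum, Polynomial.eval_mul, Polynomial.eval_C,
      Polynomial.eval_pow, Polynomial.eval_X, Polynomial.eval_zero]
    rw [← this]
    exact Finset.sum_congr rfl fun _ _ => mul_comm _ _
  have := congrArg (fun p => Polynomial.coeff p k) hp
  simpa [Polynomial.finsetSum_coeff, Polynomial.coeff_C_mul, Polynomial.coeff_X_pow, hk]
    using this

/-- Polarization. -/
theorem ad_pow_ad_eq_zero {m : ℕ} {A : Module.End ℝ R} (h : ∀ ξ, (X.ad ξ ^ (m + 1)) A = 0)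
    (ξ η : Fin d → ℝ) : (X.ad ξ ^ m) (X.ad η A) = 0 := by
  have key : ∀ t : ℝ, ∑ k ∈ Finset.range (m + 2),
      t ^ k • (((m + 1).choose k : ℝ) • (X.ad ξ ^ (m + 1 - k)) ((X.ad η ^ k) A)) = 0 := by
    intro t
    rw [← h (t • η + ξ), map_add, map_smul,
      ((X.ad_commute η ξ).smul_left t).add_pow, LinearMap.sum_apply]
    refine Finset.sum_congr rfl fun k _ => ?_
    have hc : (X.ad η ^ k) * (X.ad ξ ^ (m + 1 - k)) = (X.ad ξ ^ (m + 1 - k)) * (X.ad η ^ k) :=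
      ((X.ad_commute η ξ).pow_pow _ _)
    rw [smul_pow, smul_mul_assoc, hc, ← nsmul_eq_mul', smul_comm, LinearMap.smul_apply,
      LinearMap.smul_apply, Module.End.mul_apply, ← Nat.cast_smul_eq_nsmul ℝ]
  have := eq_zero_of_forall_sum_pow_smul _ key (k := 1) (by omega)
  simp only [Nat.choose_one_right, Nat.add_sub_cancel, pow_one, smul_eq_zero] at this
  rcases this with h' | h'
  · exact absurd h' (by positivity)
  · exact h'

theorem Ord.ad {n : ℕ} {A : Module.End ℝ R} (hA : X.Ord (n + 1) A) (η : Fin d → ℝ) :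
    X.Ord n (X.ad η A) :=
  ⟨X.ad_mem hA.1 η, fun ξ => ad_pow_ad_eq_zero hA.2 ξ η⟩

theorem Ord.ad_pow {n k : ℕ} {A : Module.End ℝ R} (hA : X.Ord (n + k) A) (η : Fin d → ℝ) :
    X.Ord n ((X.ad η ^ k) A) := by
  induction k generalizing A with
  | zero => simpa using hA
  | succ k ih =>
    rw [pow_succ, Module.End.mul_apply]
    exact ih (Ord.ad hA η)

theorem Ord.eq_lmul {A : Module.End ℝ R} (hA : X.Ord 0 A) : A = mop R (A 1) :=
  X.eq_lmul_of_ad_eq_zero hA.1 fun i => by simpa using hA.2 (Pi.single i 1)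

theorem Ord.apply_eq {A : Module.End ℝ R} (hA : X.Ord 1 A) (h : R) :
    A h = A 1 * h + ∑ i, X.ad (Pi.single i 1) A 1 * X.der i h := by
  set B : Module.End ℝ R :=
    ∑ i, mop R (X.ad (Pi.single i 1) A 1) * X.op i with hB
  have hBo : B ∈ X.diffOps := sum_mem fun i _ => by
    simpa [word] using X.lmul_mul_word_mem (X.ad (Pi.single i 1) A 1) [i]
  have h0 : ∀ j, X.ad (Pi.single j 1) (A - B) = 0 := by
    intro j
    have hj := (Ord.ad hA (Pi.single j 1)).eq_lmul
    rw [map_sub, sub_eq_zero, hB, map_sum]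
    simp only [ad_mul, ad_lmul, ad_op, zero_mul, zero_add]
    rw [Finset.sum_eq_single j]
    · simpa using hj
    · intro i _ hij
      simp [hij]
    · simp
  have := congrArg (fun T : Module.End ℝ R => T h)
    (X.eq_lmul_of_ad_eq_zero (sub_mem hA.1 hBo) h0)
  simp [hB] at this
  rw [sub_eq_iff_eq_add] at this
  exact this

variable (X)

/-- Divided power of the commutator with `ξ`. -/
def tau (n : ℕ) (ξ : Fin d → ℝ) : Module.End ℝ R →ₗ[ℝ] Module.End ℝ R :=
  (n.factorial : ℝ)⁻¹ • X.ad ξ ^ n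

theorem tau_apply (n : ℕ) (ξ : Fin d → ℝ) (A : Module.End ℝ R) :
    X.tau n ξ A = (n.factorial : ℝ)⁻¹ • (X.ad ξ ^ n) A := rfl

@[simp] theorem tau_zero (ξ : Fin d → ℝ) (A : Module.End ℝ R) : X.tau 0 ξ A = A := by
  simp [tau_apply]

theorem ad_tau (n : ℕ) (ξ : Fin d → ℝ) (A : Module.End ℝ R) :
    X.ad ξ (X.tau n ξ A) = ((n : ℝ) + 1) • X.tau (n + 1) ξ A := by
  rw [tau_apply, tau_apply, map_smul, ← Module.End.mul_apply, ← pow_succ', smul_smul]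
  congr 1
  rw [Nat.factorial_succ]
  push_cast
  field_simp

theorem tau_mul (n : ℕ) (ξ : Fin d → ℝ) (A B : Module.End ℝ R) :
    X.tau n ξ (A * B) = ∑ p ∈ antidiagonal n, X.tau p.1 ξ A * X.tau p.2 ξ B := by
  induction n with
  | zero => simp
  | succ n ih =>
    have h0 : ((n : ℝ) + 1) ≠ 0 := by positivity
    apply smul_right_injective _ h0
    simp only
    rw [← ad_tau, ih, map_sum]
    simp only [ad_mul, ad_tau, smul_mul_assoc, mul_smul_comm, Finset.sum_add_distrib]
    have e1 : ∑ p ∈ antidiagonal n,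
        ((p.1 : ℝ) + 1) • (X.tau (p.1 + 1) ξ A * X.tau p.2 ξ B) =
        ∑ p ∈ antidiagonal (n + 1), (p.1 : ℝ) • (X.tau p.1 ξ A * X.tau p.2 ξ B) := by
      rw [Finset.Nat.sum_antidiagonal_succ]
      simp
    have e2 : ∑ p ∈ antidiagonal n,
        ((p.2 : ℝ) + 1) • (X.tau p.1 ξ A * X.tau (p.2 + 1) ξ B) =
        ∑ p ∈ antidiagonal (n + 1), (p.2 : ℝ) • (X.tau p.1 ξ A * X.tau p.2 ξ B) := by
      rw [Finset.Nat.sum_antidiagonal_succ']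
      simp
    rw [e1, e2, ← Finset.sum_add_distrib, Finset.smul_sum]
    refine Finset.sum_congr rfl fun p hp => ?_
    rw [← add_smul]
    congr 1
    exact_mod_cast mem_antidiagonal.1 hp

variable {X}

theorem Ord.tau_eq_zero {r n : ℕ} (hrn : r < n) {A : Module.End ℝ R} (hA : X.Ord r A)
    (ξ : Fin d → ℝ) : X.tau n ξ A = 0 := by
  rw [tau_apply, X.ad_pow_eq_zero_of_le hrn (hA.2 ξ), smul_zero]

theorem Ord.tau_mul {r s : ℕ} {A B : Module.End ℝ R} (hA : X.Ord r A) (hB : X.Ord s B)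
    (ξ : Fin d → ℝ) : X.tau (r + s) ξ (A * B) = X.tau r ξ A * X.tau s ξ B := by
  rw [X.tau_mul, Finset.sum_eq_single (r, s)]
  · rintro ⟨i, j⟩ hij hne
    rw [mem_antidiagonal] at hij
    simp only at hij
    rcases lt_trichotomy i r with h | h | h
    · rw [hB.tau_eq_zero (show s < j by omega), mul_zero]
    · exact absurd (Prod.ext h (by simp only; omega)) hne
    · rw [hA.tau_eq_zero h, zero_mul]
  · simp

theorem Ord.smul {n : ℕ} {A : Module.End ℝ R} (hA : X.Ord n A) (c : ℝ) : X.Ord n (c • A) :=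
  ⟨Submodule.smul_mem _ _ hA.1, fun ξ => by rw [map_smul, hA.2, smul_zero]⟩

theorem Ord.tau {n k : ℕ} {A : Module.End ℝ R} (hA : X.Ord (n + k) A) (ξ : Fin d → ℝ) :
    X.Ord n (X.tau k ξ A) := (hA.ad_pow ξ).smul _

variable (X)

/-- The principal symbol of order `n`, at a fixed covector `ξ`. -/
def sym (n : ℕ) (ξ : Fin d → ℝ) : Module.End ℝ R →ₗ[ℝ] R :=
  LinearMap.applyₗ 1 ∘ₗ X.tau n ξ

theorem sym_apply (n : ℕ) (ξ : Fin d → ℝ) (A : Module.End ℝ R) :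
    X.sym n ξ A = X.tau n ξ A 1 := rfl

variable {X} in
theorem Ord.tau_eq {n : ℕ} {A : Module.End ℝ R} (hA : X.Ord n A) (ξ : Fin d → ℝ) :
    X.tau n ξ A = mop R (X.sym n ξ A) :=
  (Ord.tau (n := 0) (by rwa [zero_add]) ξ).eq_lmul

/-- The derivative of the symbol in the direction of the `i`-th fiber variable. -/
def dsym (n : ℕ) (ξ : Fin d → ℝ) (i : Fin d) : Module.End ℝ R →ₗ[ℝ] R :=
  ((n.factorial : ℝ)⁻¹ * n) •
    LinearMap.applyₗ 1 ∘ₗ X.ad (Pi.single i 1) ∘ₗ X.ad ξ ^ (n - 1)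

theorem dsym_zero (ξ : Fin d → ℝ) (i : Fin d) : X.dsym 0 ξ i = 0 := by
  simp [dsym]

theorem dsym_succ (n : ℕ) (ξ : Fin d → ℝ) (i : Fin d) (A : Module.End ℝ R) :
    X.dsym (n + 1) ξ i A = X.ad (Pi.single i 1) (X.tau n ξ A) 1 := by
  have : (((n + 1).factorial : ℝ)⁻¹ * ((n + 1 : ℕ) : ℝ)) = (n.factorial : ℝ)⁻¹ := by
    rw [Nat.factorial_succ]; push_cast; field_simp
  simp only [dsym, this, tau_apply, map_smul]
  rfl

/-- The Poisson bracket of the symbols of order `r` and `s`. -/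
def pb (r s : ℕ) (ξ : Fin d → ℝ) (A B : Module.End ℝ R) : R :=
  ∑ i, (X.dsym r ξ i A * X.der i (X.sym s ξ B) - X.der i (X.sym r ξ A) * X.dsym s ξ i B)

variable {X}

theorem Ord.sym_mul {r s : ℕ} {A B : Module.End ℝ R} (hA : X.Ord r A) (hB : X.Ord s B)
    (ξ : Fin d → ℝ) :
    X.sym (r + s) ξ (A * B) = X.sym r ξ A * X.sym s ξ B := by
  rw [sym_apply, hA.tau_mul hB, hA.tau_eq, hB.tau_eq]
  simp

/-- The sum of the commutators `[τ_i A, τ_j B]` over `i + j = n` reduces to two terms. -/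
theorem tau_commutator (n : ℕ) (ξ : Fin d → ℝ) (A B : Module.End ℝ R) :
    X.tau n ξ (A * B - B * A) = ∑ p ∈ antidiagonal n,
      (X.tau p.1 ξ A * X.tau p.2 ξ B - X.tau p.2 ξ B * X.tau p.1 ξ A) := by
  rw [map_sub, X.tau_mul, X.tau_mul, Finset.sum_sub_distrib]
  congr 1
  rw [← Finset.Nat.sum_antidiagonal_swap]
  rfl

theorem sym_lmul_commutator {s : ℕ} {B : Module.End ℝ R} (hB : X.Ord (s + 1) B)
    (ξ : Fin d → ℝ) (a : R) :
    (mop R a * X.tau s ξ B - X.tau s ξ B * mop R a) 1 =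
      -∑ i, X.der i a * X.dsym (s + 1) ξ i B := by
  have h := (Ord.tau (n := 1) (k := s) (by rwa [add_comm]) ξ : X.Ord 1 (X.tau s ξ B)).apply_eq a
  simp only [LinearMap.sub_apply, Module.End.mul_apply, mop_apply, mul_one, h, dsym_succ]
  rw [mul_comm a, sub_add_cancel_left]
  congr 1
  exact Finset.sum_congr rfl fun _ _ => mul_comm _ _

theorem sym_commutator {n r s : ℕ} (hn : r + s = n + 1) {A B : Module.End ℝ R}
    (hA : X.Ord r A) (hB : X.Ord s B) (ξ : Fin d → ℝ) :
    X.sym n ξ (A * B - B * A) = X.pb r s ξ A B := by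
  have key : ∀ i j, i + j = n → (i + 1 ≠ r ∨ j ≠ s) → (i ≠ r ∨ j + 1 ≠ s) →
      X.tau i ξ A * X.tau j ξ B - X.tau j ξ B * X.tau i ξ A = 0 := by
    intro i j hij h1 h2
    by_cases hi : r < i
    · simp [hA.tau_eq_zero hi]
    · rw [hB.tau_eq_zero (show s < j by omega)]; simp
  have e1 := fun s' (hs : s = s' + 1) => sym_lmul_commutator (hs ▸ hB) ξ (X.sym r ξ A)
  have e2 := fun r' (hr : r = r' + 1) => sym_lmul_commutator (hr ▸ hA) ξ (X.sym s ξ B)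
  rw [pb, Finset.sum_sub_distrib, sym_apply, tau_commutator]
  rcases r with _ | r <;> rcases s with _ | s
  · omega
  · rw [Finset.sum_eq_single (0, s), hA.tau_eq, e1 s rfl]
    · simp [dsym_zero]
    · rintro ⟨i, j⟩ hij hne
      rw [mem_antidiagonal] at hij
      refine key i j hij (by omega) ?_
      by_contra! h
      exact hne (Prod.ext (by simp only; omega) (by simp only; omega))
    · intro h; exact absurd (mem_antidiagonal.2 (by simp only; omega)) h
  · rw [Finset.sum_eq_single (r, 0), hB.tau_eq, ← neg_sub, LinearMap.neg_apply, e2 r rfl]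
    · simp [dsym_zero, mul_comm]
    · rintro ⟨i, j⟩ hij hne
      rw [mem_antidiagonal] at hij
      refine key i j hij ?_ (by omega)
      by_contra! h
      exact hne (Prod.ext (by simp only; omega) (by simp only; omega))
    · intro h; exact absurd (mem_antidiagonal.2 (by simp only; omega)) h
  · have hne : ((r + 1, s) : ℕ × ℕ) ≠ (r, s + 1) := by simp
    rw [Finset.sum_eq_add (r + 1, s) (r, s + 1) hne, hA.tau_eq, hB.tau_eq, LinearMap.add_apply,
      e1 s rfl, ← neg_sub (mop R _ * _), LinearMap.neg_apply, e2 r rfl, neg_neg,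
      add_comm, ← sub_eq_add_neg]
    · simp [mul_comm]
    · rintro ⟨i, j⟩ hij hne
      rw [mem_antidiagonal] at hij
      simp only [ne_eq, Prod.mk.injEq] at hne hij
      exact key i j hij (by omega) (by omega)
    · intro h; exact absurd (mem_antidiagonal.2 (by simp only; omega)) h
    · intro h; exact absurd (mem_antidiagonal.2 (by simp only; omega)) h

theorem Ord.of_sym_eq_zero {n : ℕ} {A : Module.End ℝ R} (hA : X.Ord (n + 1) A)
    (h : ∀ ξ, X.sym (n + 1) ξ A = 0) : X.Ord n A := by
  refine ⟨hA.1, fun ξ => ?_⟩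
  have h1 := hA.tau_eq ξ
  rw [h, map_zero, tau_apply, smul_eq_zero] at h1
  exact h1.resolve_left (by positivity)

variable (X)

/-- Two natural formal operators with the same symbol. -/
structure Close (L L' : ℕ → Module.End ℝ R) : Prop where
  left : ∀ r, X.Ord r (L r)
  right : ∀ r, X.Ord r (L' r)
  zero : L 0 = L' 0
  diff : ∀ r, X.Ord r (L (r + 1) - L' (r + 1))

variable {X}

theorem Close.of_sym_eq {L L' : ℕ → Module.End ℝ R} (hL : ∀ r, X.Ord r (L r))
    (hL' : ∀ r, X.Ord r (L' r)) (h0 : L 0 = L' 0)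
    (h : ∀ r ξ, X.sym r ξ (L r) = X.sym r ξ (L' r)) : X.Close L L' :=
  ⟨hL, hL', h0, fun r => ((hL _).sub (hL' _)).of_sym_eq_zero fun ξ => by
    rw [map_sub, h, sub_self]⟩

theorem Close.sym_eq {L L' : ℕ → Module.End ℝ R} (h : X.Close L L') (r : ℕ) (ξ : Fin d → ℝ) :
    X.sym r ξ (L r) = X.sym r ξ (L' r) := by
  cases r with
  | zero => rw [h.zero]
  | succ r =>
    rw [← sub_eq_zero, ← map_sub, sym_apply, (h.diff r).tau_eq_zero (Nat.lt_succ_self r)]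
    rfl

theorem Close.dsym_eq {L L' : ℕ → Module.End ℝ R} (h : X.Close L L') (r : ℕ) (ξ : Fin d → ℝ)
    (i : Fin d) : X.dsym r ξ i (L r) = X.dsym r ξ i (L' r) := by
  cases r with
  | zero => rw [h.zero]
  | succ r =>
    rw [← sub_eq_zero, ← map_sub, dsym_succ, (h.diff r).tau_eq, ad_lmul]
    rfl

theorem Close.pb_eq {M M' : ℕ → Module.End ℝ R} (h : X.Close M M') (r s : ℕ) (ξ : Fin d → ℝ)
    (A : Module.End ℝ R) : X.pb r s ξ A (M s) = X.pb r s ξ A (M' s) := by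
  simp only [pb, h.sym_eq, h.dsym_eq]

theorem sum_antidiagonal_sub {E : Type*} [AddCommGroup E] (β : E → E → E)
    (hl : ∀ a b c, β (a - b) c = β a c - β b c) (hr : ∀ a b c, β a (b - c) = β a b - β a c)
    {L L' M M' : ℕ → E} (hL : L 0 = L' 0) (hM : M 0 = M' 0) (n : ℕ) :
    ∑ p ∈ antidiagonal (n + 1), (β (L p.1) (M p.2) - β (L' p.1) (M' p.2)) =
      ∑ p ∈ antidiagonal n, (β (L p.1) (M (p.2 + 1) - M' (p.2 + 1)) +
        β (L (p.1 + 1) - L' (p.1 + 1)) (M' p.2)) := by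
  have h : ∀ p : ℕ × ℕ, β (L p.1) (M p.2) - β (L' p.1) (M' p.2) =
      β (L p.1) (M p.2 - M' p.2) + β (L p.1 - L' p.1) (M' p.2) := fun p => by
    rw [hl, hr]; abel
  have z1 : ∀ a, β a 0 = 0 := fun a => by simpa using hr a 0 0
  have z2 : ∀ a, β 0 a = 0 := fun a => by simpa using hl 0 0 a
  rw [Finset.sum_congr rfl fun p _ => h p, Finset.sum_add_distrib, Finset.sum_add_distrib,
    Finset.Nat.sum_antidiagonal_succ', Finset.Nat.sum_antidiagonal_succ]
  simp [hL, hM, z1, z2]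

theorem Close.sym_sum_mul {L L' M M' : ℕ → Module.End ℝ R} (hL : X.Close L L')
    (hM : X.Close M M') (n : ℕ) (ξ : Fin d → ℝ) :
    X.sym n ξ (∑ p ∈ antidiagonal (n + 1), (L p.1 * M p.2 - L' p.1 * M' p.2)) =
      ∑ p ∈ antidiagonal n, (X.sym p.1 ξ (L p.1) * X.sym p.2 ξ (M (p.2 + 1) - M' (p.2 + 1)) +
        X.sym p.1 ξ (L (p.1 + 1) - L' (p.1 + 1)) * X.sym p.2 ξ (M p.2)) := by
  rw [sum_antidiagonal_sub (fun A B : Module.End ℝ R => A * B) sub_mul mul_sub hL.zero hM.zero,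
    map_sum]
  refine Finset.sum_congr rfl fun p hp => ?_
  obtain rfl := mem_antidiagonal.1 hp
  rw [map_add, (hL.left _).sym_mul (hM.diff _), (hL.diff _).sym_mul (hM.right _), hM.sym_eq]

theorem Close.sym_sum_commutator {L L' M M' : ℕ → Module.End ℝ R} (hL : X.Close L L')
    (hM : X.Close M M') (n : ℕ) (ξ : Fin d → ℝ) :
    X.sym n ξ (∑ p ∈ antidiagonal (n + 2),
        ((L p.1 * M p.2 - M p.2 * L p.1) - (L' p.1 * M' p.2 - M' p.2 * L' p.1))) =
      ∑ p ∈ antidiagonal (n + 1), (X.pb p.1 p.2 ξ (L p.1) (M (p.2 + 1) - M' (p.2 + 1)) +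
        X.pb p.1 p.2 ξ (L (p.1 + 1) - L' (p.1 + 1)) (M p.2)) := by
  rw [sum_antidiagonal_sub (fun A B : Module.End ℝ R => A * B - B * A)
    (fun a b c => by rw [sub_mul, mul_sub]; abel) (fun a b c => by rw [sub_mul, mul_sub]; abel)
    hL.zero hM.zero, map_sum]
  refine Finset.sum_congr rfl fun p hp => ?_
  have hp := mem_antidiagonal.1 hp
  rw [map_add, sym_commutator hp (hL.left _) (hM.diff _),
    sym_commutator hp (hL.diff _) (hM.right _), hM.pb_eq]

variable (X)

/-- A natural star product on the algebra `R`. -/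
structure Star where
  c : ℕ → R →ₗ[ℝ] R →ₗ[ℝ] R
  ord_left : ∀ r f, X.Ord r (c r f)
  ord_right : ∀ r f, X.Ord r ((c r).flip f)
  zero : ∀ f g, c 0 f g = f * g
  one_left : ∀ r f, c (r + 1) 1 f = 0
  one_right : ∀ r f, c (r + 1) f 1 = 0
  assoc : ∀ r f g h, ∑ p ∈ antidiagonal r, c p.1 (c p.2 f g) h =
    ∑ p ∈ antidiagonal r, c p.1 f (c p.2 g h)

variable {X}

namespace Star

/-- The opposite star product. -/
def opp (S : X.Star) : X.Star where
  c r := (S.c r).flip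
  ord_left := S.ord_right
  ord_right := S.ord_left
  zero f g := by rw [LinearMap.flip_apply, S.zero, mul_comm]
  one_left r f := S.one_right r f
  one_right r f := S.one_left r f
  assoc r f g h := (S.assoc r h g f).symm

variable (S S' : X.Star)

theorem zero_eq (f : R) : S.c 0 f = mop R f := LinearMap.ext fun g => S.zero f g

theorem sum_mul (n : ℕ) (f g : R) : ∑ p ∈ antidiagonal n, S.c p.1 f * S.c p.2 g =
    ∑ p ∈ antidiagonal n, S.c p.1 (S.c p.2 f g) := by
  ext u
  simp only [LinearMap.sum_apply, Module.End.mul_apply]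
  exact (S.assoc n f g u).symm

theorem sum_mul_flip (n : ℕ) (f g : R) :
    ∑ p ∈ antidiagonal n, (S.c p.1 f * (S.c p.2).flip g - (S.c p.2).flip g * S.c p.1 f) = 0 := by
  rw [Finset.sum_sub_distrib, sub_eq_zero]
  ext u
  simp only [LinearMap.sum_apply, Module.End.mul_apply, LinearMap.flip_apply]
  rw [← S.assoc n f u g, ← Finset.Nat.sum_antidiagonal_swap]
  rfl

variable {S S'}

theorem close (h : ∀ f r ξ, X.sym r ξ (S.c r f) = X.sym r ξ (S'.c r f)) (f : R) :
    X.Close (fun r => S.c r f) (fun r => S'.c r f) :=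
  Close.of_sym_eq (fun r => S.ord_left r f) (fun r => S'.ord_left r f)
    (by rw [S.zero_eq, S'.zero_eq]) (h f)

theorem one_eq (h : ∀ f r ξ, X.sym r ξ (S.c r f) = X.sym r ξ (S'.c r f)) (f g : R) :
    S.c 1 f g = S'.c 1 f g := by
  have h1 := ((close h f).diff 0).eq_lmul
  simp only [zero_add, LinearMap.sub_apply] at h1
  have h2 := S.one_right 0 f
  have h3 := S'.one_right 0 f
  rw [zero_add] at h2 h3
  rw [h2, h3, sub_self, map_zero] at h1
  exact sub_eq_zero.1 (congrArg (fun A : Module.End ℝ R => A g) h1)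

theorem sym_eq_zero_of_lt {r n : ℕ} (hr : r < n) (ξ : Fin d → ℝ) (f : R) :
    X.sym n ξ (S.c r f) = 0 := by
  rw [sym_apply, (S.ord_left r f).tau_eq_zero hr]; rfl

theorem sym_diff_mul (h : ∀ f r ξ, X.sym r ξ (S.c r f) = X.sym r ξ (S'.c r f)) (f g : R)
    (n : ℕ) (ξ : Fin d → ℝ) :
    X.sym n ξ (S.c (n + 1) (f * g) - S'.c (n + 1) (f * g)) =
      ∑ p ∈ antidiagonal n,
        (X.sym p.1 ξ (S.c p.1 f) * X.sym p.2 ξ (S.c (p.2 + 1) g - S'.c (p.2 + 1) g) +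
          X.sym p.1 ξ (S.c (p.1 + 1) f - S'.c (p.1 + 1) f) * X.sym p.2 ξ (S.c p.2 g)) := by
  rw [← (close h f).sym_sum_mul (close h g), Finset.sum_sub_distrib, S.sum_mul, S'.sum_mul,
    ← Finset.sum_sub_distrib, Finset.Nat.sum_antidiagonal_succ', map_add, S.zero, S'.zero,
    left_eq_add, map_sum]
  refine Finset.sum_eq_zero fun p hp => ?_
  have hp := mem_antidiagonal.1 hp
  obtain ⟨i, j⟩ := p
  simp only at hp ⊢
  rw [map_sub]
  rcases j with _ | j
  · obtain rfl : i = n := by omega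
    rw [zero_add, one_eq h, h, sub_self]
  · rw [sym_eq_zero_of_lt (by omega), sym_eq_zero_of_lt (by omega), sub_self]

theorem sym_diff_commutator (h : ∀ f r ξ, X.sym r ξ (S.c r f) = X.sym r ξ (S'.c r f))
    (f g : R) (n : ℕ) (ξ : Fin d → ℝ) :
    X.sym n ξ (S.c (n + 1) (S.c 1 f g - S.c 1 g f) - S'.c (n + 1) (S.c 1 f g - S.c 1 g f)) +
        X.sym n ξ (S.c n ((S.c 2 f g - S.c 2 g f) - (S'.c 2 f g - S'.c 2 g f))) =
      ∑ p ∈ antidiagonal (n + 1),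
        (X.pb p.1 p.2 ξ (S.c p.1 f) (S.c (p.2 + 1) g - S'.c (p.2 + 1) g) +
          X.pb p.1 p.2 ξ (S.c (p.1 + 1) f - S'.c (p.1 + 1) f) (S.c p.2 g)) := by
  have hcomm : ∀ T : X.Star, ∑ p ∈ antidiagonal (n + 2),
      (T.c p.1 f * T.c p.2 g - T.c p.2 g * T.c p.1 f) =
      ∑ p ∈ antidiagonal (n + 2), T.c p.1 (T.c p.2 f g - T.c p.2 g f) := fun T => by
    simp only [map_sub, Finset.sum_sub_distrib]
    rw [← T.sum_mul, ← T.sum_mul]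
    congr 1
    rw [← Finset.Nat.sum_antidiagonal_swap]
    rfl
  rw [← (close h f).sym_sum_commutator (close h g), Finset.sum_sub_distrib, hcomm, hcomm,
    ← Finset.sum_sub_distrib, Finset.Nat.sum_antidiagonal_succ',
    Finset.Nat.sum_antidiagonal_succ', map_add, map_add]
  have e0 : ∀ T : X.Star, T.c 0 f g - T.c 0 g f = 0 := fun T => by
    rw [T.zero, T.zero, mul_comm, sub_self]
  rw [e0, e0, map_zero, map_zero, sub_zero, map_zero, zero_add, zero_add, ← one_eq h f g,
    ← one_eq h g f, add_right_inj, map_sum, Finset.sum_eq_single (n, 0)]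
  · rw [map_sub (S.c n), map_sub (X.sym n ξ), map_sub (X.sym n ξ), h (S'.c 2 f g - S'.c 2 g f)]
  · rintro ⟨i, j⟩ hp hne
    have hp := mem_antidiagonal.1 hp
    have : i < n := by
      by_contra! h'
      exact hne (Prod.ext (by simp only at hp ⊢; omega) (by simp only at hp ⊢; omega))
    rw [map_sub, sym_eq_zero_of_lt this, sym_eq_zero_of_lt this, sub_self]
  · intro h'; exact absurd (mem_antidiagonal.2 (by simp)) h'

theorem diff_apply_one (S S' : X.Star) (r : ℕ) (f : R) :
    (S.c (r + 1) f - S'.c (r + 1) f) 1 = 0 := by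
  rw [LinearMap.sub_apply, S.one_right, S'.one_right, sub_zero]

theorem sym_diff_neg (a b : R) (n : ℕ) (ξ : Fin d → ℝ) :
    X.sym n ξ (S.c (n + 1) (-a) - S'.c (n + 1) (-a)) + X.sym n ξ (S.c n (-b)) =
      -(X.sym n ξ (S.c (n + 1) a - S'.c (n + 1) a) + X.sym n ξ (S.c n b)) := by
  simp only [← neg_one_smul ℝ a, ← neg_one_smul ℝ b, map_smul, map_sub]
  module

theorem sym_mixed (h : ∀ f r ξ, X.sym r ξ (S.c r f) = X.sym r ξ (S'.c r f))
    (h' : ∀ f r ξ, X.sym r ξ ((S.c r).flip f) = X.sym r ξ ((S'.c r).flip f))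
    (f g : R) (n : ℕ) (ξ : Fin d → ℝ) :
    ∑ p ∈ antidiagonal (n + 1),
        (X.pb p.1 p.2 ξ (S.c p.1 f) ((S.c (p.2 + 1)).flip g - (S'.c (p.2 + 1)).flip g) +
          X.pb p.1 p.2 ξ (S.c (p.1 + 1) f - S'.c (p.1 + 1) f) ((S.c p.2).flip g)) = 0 := by
  refine ((close h f).sym_sum_commutator
    (close (S := S.opp) (S' := S'.opp) h' g) n ξ).symm.trans ?_
  rw [Finset.sum_sub_distrib]
  have h1 := S.sum_mul_flip (n + 2) f g
  have h2 := S'.sum_mul_flip (n + 2) f g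
  exact (congrArg _ ((congrArg₂ _ h1 h2).trans (sub_self 0))).trans (map_zero _)

end Star

end CoordAlg

section Concrete

variable {d : ℕ} {U : Set (Fin d → ℝ)}

open Classical in
/-- Extension by zero of a function on `U`. -/
def extZero (U : Set (Fin d → ℝ)) (f : U → ℝ) : Rfn d := fun x => if h : x ∈ U then f ⟨x, h⟩ else 0

theorem extZero_apply (f : U → ℝ) {x : Fin d → ℝ} (hx : x ∈ U) : extZero U f x = f ⟨x, hx⟩ :=
  dif_pos hx

/-- The algebra of smooth functions on `U`. -/
def smoothAlg (U : Set (Fin d → ℝ)) : Subalgebra ℝ (U → ℝ) where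
  carrier := {f | ContDiffOn ℝ (⊤ : ℕ∞) (extZero U f) U}
  mul_mem' {f g} hf hg := (ContDiffOn.mul hf hg).congr fun x hx => by simp [extZero_apply _ hx]
  add_mem' {f g} hf hg := (ContDiffOn.add hf hg).congr fun x hx => by simp [extZero_apply _ hx]
  algebraMap_mem' c := (contDiffOn_const (c := c)).congr fun x hx => by simp [extZero_apply _ hx]

/-- Evaluation at a point (zero outside of `U`). -/
def ev (U : Set (Fin d → ℝ)) (x : Fin d → ℝ) : smoothAlg U →ₗ[ℝ] ℝ where
  toFun f := extZero U f x
  map_add' f g := by by_cases h : x ∈ U <;> simp [extZero, h]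
  map_smul' c f := by by_cases h : x ∈ U <;> simp [extZero, h]

@[simp] theorem ev_mul (x : Fin d → ℝ) (f g : smoothAlg U) :
    ev U x (f * g) = ev U x f * ev U x g := by
  by_cases h : x ∈ U <;> simp [ev, extZero, h]

theorem ev_one {x : Fin d → ℝ} (hx : x ∈ U) : ev U x 1 = 1 := by simp [ev, extZero, hx]

theorem ext_ev {f g : smoothAlg U} (h : ∀ x ∈ U, ev U x f = ev U x g) : f = g := by
  ext ⟨x, hx⟩
  simpa [ev, extZero, hx] using h x hx

theorem contDiffOn_ev (f : smoothAlg U) : ContDiffOn ℝ (⊤ : ℕ∞) (fun x => ev U x f) U := f.2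

/-- Restriction to `U` of a function which is smooth on `U`. -/
def res (F : Rfn d) (hF : ContDiffOn ℝ (⊤ : ℕ∞) F U) : smoothAlg U :=
  ⟨fun x => F x, hF.congr fun _ hx => extZero_apply _ hx⟩

theorem ev_res (F : Rfn d) (hF : ContDiffOn ℝ (⊤ : ℕ∞) F U) {x : Fin d → ℝ} (hx : x ∈ U) :
    ev U x (res F hF) = F x := extZero_apply _ hx

theorem res_ev (f : smoothAlg U) : res _ (contDiffOn_ev f) = f :=
  ext_ev fun _ hx => ev_res _ _ hx

theorem pderi_congr (hU : IsOpen U) (i : Fin d) {F G : Rfn d} (h : Set.EqOn F G U) :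
    Set.EqOn (pderi i F) (pderi i G) U := fun x hx => by
  have : F =ᶠ[nhds x] G := Filter.eventuallyEq_of_mem (hU.mem_nhds hx) h
  simp only [pderi, this.fderiv_eq]

theorem contDiffOn_pderi (hU : IsOpen U) (i : Fin d) {F : Rfn d}
    (hF : ContDiffOn ℝ (⊤ : ℕ∞) F U) : ContDiffOn ℝ (⊤ : ℕ∞) (pderi i F) U :=
  (hF.fderiv_of_isOpen hU (by simp)).clm_apply contDiffOn_const

theorem differentiableAt_ev (hU : IsOpen U) (f : smoothAlg U) {x : Fin d → ℝ} (hx : x ∈ U) :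
    DifferentiableAt ℝ (fun y => ev U y f) x :=
  ((contDiffOn_ev f).contDiffAt (hU.mem_nhds hx)).differentiableAt (by simp)

/-- The partial derivatives of smooth functions on `U`. -/
def partialDer (hU : IsOpen U) (i : Fin d) : Derivation ℝ (smoothAlg U) (smoothAlg U) :=
  Derivation.mk'
    { toFun := fun f => res _ (contDiffOn_pderi hU i (contDiffOn_ev f))
      map_add' := fun f g => ext_ev fun x hx => by
        simp only [map_add, ev_res _ _ hx, pderi]
        rw [fderiv_fun_add (differentiableAt_ev hU f hx) (differentiableAt_ev hU g hx)]
        rfl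
      map_smul' := fun c f => ext_ev fun x hx => by
        simp only [map_smul, ev_res _ _ hx, pderi, RingHom.id_apply]
        rw [fderiv_fun_const_smul (differentiableAt_ev hU f hx)]
        rfl }
    fun f g => ext_ev fun x hx => by
      simp only [LinearMap.coe_mk, AddHom.coe_mk, ev_res _ _ hx, pderi, map_add, ev_mul,
        smul_eq_mul]
      rw [fderiv_fun_mul (differentiableAt_ev hU f hx) (differentiableAt_ev hU g hx)]
      simp

theorem ev_partialDer (hU : IsOpen U) (i : Fin d) (f : smoothAlg U) {x : Fin d → ℝ}
    (hx : x ∈ U) : ev U x (partialDer hU i f) = pderi i (fun y => ev U y f) x :=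
  ev_res _ (contDiffOn_pderi hU i (contDiffOn_ev f)) hx

theorem pderi_comm (hU : IsOpen U) (i j : Fin d) {F : Rfn d} (hF : ContDiffOn ℝ (⊤ : ℕ∞) F U)
    {x : Fin d → ℝ} (hx : x ∈ U) : pderi i (pderi j F) x = pderi j (pderi i F) x := by
  have hd : DifferentiableAt ℝ (fderiv ℝ F) x :=
    ((hF.fderiv_of_isOpen hU (m := (⊤ : ℕ∞)) (by simp)).contDiffAt
      (hU.mem_nhds hx)).differentiableAt (by simp)
  have hs : IsSymmSndFDerivAt ℝ F x :=
    (hF.contDiffAt (hU.mem_nhds hx)).isSymmSndFDerivAt (by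
      rw [minSmoothness_of_isRCLikeNormedField]
      exact WithTop.coe_le_coe.2 (le_top : (2 : ℕ∞) ≤ ⊤))
  have key : ∀ k l : Fin d, pderi k (pderi l F) x =
      fderiv ℝ (fderiv ℝ F) x (Pi.single k 1) (Pi.single l 1) := fun k l => by
    unfold pderi
    rw [fderiv_clm_apply hd (differentiableAt_const _)]
    simp
  rw [key, key, hs.eq]

/-- Smooth functions on `U` with the standard coordinates. -/
def coords (hU : IsOpen U) : CoordAlg d (smoothAlg U) where
  der := partialDer hU
  x i := res (fun y => y i) (contDiff_apply ℝ ℝ i).contDiffOn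
  comm i j f := ext_ev fun x hx => by
    rw [ev_partialDer _ _ _ hx, ev_partialDer _ _ _ hx,
      pderi_congr hU i (fun y hy => ev_partialDer hU j f hy) hx,
      pderi_congr hU j (fun y hy => ev_partialDer hU i f hy) hx,
      pderi_comm hU i j (contDiffOn_ev f) hx]
  dual i j := ext_ev fun x hx => by
    rw [ev_partialDer _ _ _ hx, pderi_congr hU i (fun y hy => ev_res _ _ hy) hx]
    have : HasFDerivAt (fun y : Fin d → ℝ => y j) (ContinuousLinearMap.proj (R := ℝ) j) x :=
      hasFDerivAt_apply j x
    rw [pderi, this.fderiv, ContinuousLinearMap.proj_apply, Pi.single_apply]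
    by_cases h : i = j
    · simp [h, ev_one hx]
    · simp [h, Ne.symm h]

theorem ev_word (hU : IsOpen U) (L : List (Fin d)) (F : Rfn d)
    (hF : ContDiffOn ℝ (⊤ : ℕ∞) F U) {x : Fin d → ℝ} (hx : x ∈ U) :
    ev U x ((coords hU).word L (res F hF)) = pderL L F x := by
  induction L generalizing x with
  | nil => exact ev_res F hF hx
  | cons j L ih =>
    exact (ev_partialDer hU j _ hx).trans (pderi_congr hU j (fun y hy => ih hy) hx)

theorem IsBidiffOpOn.exists_linear (hU : IsOpen U) {N : ℕ} {B : Rfn d → Rfn d → Rfn d}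
    (hB : IsBidiffOpOn U N B) : ∃ b : smoothAlg U →ₗ[ℝ] smoothAlg U →ₗ[ℝ] smoothAlg U,
      (∀ f, (coords hU).Ord N (b f)) ∧ (∀ f, (coords hU).Ord N (b.flip f)) ∧
      ∀ F G hF hG, ∀ x ∈ U, ev U x (b (res F hF) (res G hG)) = B F G x := by
  obtain ⟨s, a, hs, ha, hB⟩ := hB
  set X := coords hU
  refine ⟨∑ p ∈ s, (LinearMap.mul ℝ (smoothAlg U)).compl₁₂
    (mop _ (res (a p) (ha p)) * X.word p.1) (X.word p.2), fun f => ?_, fun f => ?_, ?_⟩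
  · have : (∑ p ∈ s, (LinearMap.mul ℝ (smoothAlg U)).compl₁₂
        (mop _ (res (a p) (ha p)) * X.word p.1) (X.word p.2)) f =
        ∑ p ∈ s, mop _ (res (a p) (ha p) * X.word p.1 f) * X.word p.2 := by
      ext1 u; simp [LinearMap.sum_apply]
    rw [this]
    exact CoordAlg.Ord.sum s fun p hp => (CoordAlg.ord_lmul_mul_word _ _).mono (hs p hp).2
  · have : (∑ p ∈ s, (LinearMap.mul ℝ (smoothAlg U)).compl₁₂
        (mop _ (res (a p) (ha p)) * X.word p.1) (X.word p.2)).flip f =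
        ∑ p ∈ s, mop _ (res (a p) (ha p) * X.word p.2 f) * X.word p.1 := by
      ext1 u
      simp only [LinearMap.sum_apply, LinearMap.flip_apply, LinearMap.compl₁₂_apply,
        LinearMap.mul_apply', Module.End.mul_apply, mop_apply]
      exact Finset.sum_congr rfl fun _ _ => mul_right_comm _ _ _
    rw [this]
    exact CoordAlg.Ord.sum s fun p hp => (CoordAlg.ord_lmul_mul_word _ _).mono (hs p hp).1
  · intro F G hF hG x hx
    rw [hB F G x hx]
    simp only [LinearMap.sum_apply, LinearMap.compl₁₂_apply,
        LinearMap.mul_apply', Module.End.mul_apply, mop_apply, map_sum, ev_mul, X,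
        ev_word _ _ _ _ hx, ev_res _ _ hx]

variable {π₀ : Fin d → Fin d → Rfn d}

/-- The components of a star product as bilinear maps on the smooth functions on `U`. -/
def NatStar.lin (SP : NatStar d U π₀) (hU : IsOpen U) (r : ℕ) :
    smoothAlg U →ₗ[ℝ] smoothAlg U →ₗ[ℝ] smoothAlg U :=
  ((SP.natural r).exists_linear hU).choose

theorem NatStar.ev_lin (SP : NatStar d U π₀) (hU : IsOpen U) (r : ℕ) {F G : Rfn d}
    (hF : ContDiffOn ℝ (⊤ : ℕ∞) F U) (hG : ContDiffOn ℝ (⊤ : ℕ∞) G U) {x : Fin d → ℝ}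
    (hx : x ∈ U) : ev U x (SP.lin hU r (res F hF) (res G hG)) = SP.C r F G x :=
  ((SP.natural r).exists_linear hU).choose_spec.2.2 F G hF hG x hx

theorem NatStar.contDiffOn_C (SP : NatStar d U π₀) (hU : IsOpen U) (r : ℕ) {F G : Rfn d}
    (hF : ContDiffOn ℝ (⊤ : ℕ∞) F U) (hG : ContDiffOn ℝ (⊤ : ℕ∞) G U) :
    ContDiffOn ℝ (⊤ : ℕ∞) (SP.C r F G) U :=
  (contDiffOn_ev (SP.lin hU r (res F hF) (res G hG))).congr fun _ hx =>
    (SP.ev_lin hU r hF hG hx).symm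

theorem NatStar.lin_res (SP : NatStar d U π₀) (hU : IsOpen U) (r : ℕ) {F G : Rfn d}
    (hF : ContDiffOn ℝ (⊤ : ℕ∞) F U) (hG : ContDiffOn ℝ (⊤ : ℕ∞) G U) :
    SP.lin hU r (res F hF) (res G hG) = res (SP.C r F G) (SP.contDiffOn_C hU r hF hG) :=
  ext_ev fun _ hx => by rw [SP.ev_lin hU r hF hG hx, ev_res _ _ hx]

theorem res_one : res (U := U) (fun _ => 1) contDiffOn_const = 1 :=
  ext_ev fun _ hx => by rw [ev_res _ _ hx, ev_one hx]

/-- The star product on the algebra of smooth functions on `U`. -/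
def NatStar.toStar (SP : NatStar d U π₀) (hU : IsOpen U) : (coords hU).Star where
  c := SP.lin hU
  ord_left r := ((SP.natural r).exists_linear hU).choose_spec.1
  ord_right r := ((SP.natural r).exists_linear hU).choose_spec.2.1
  zero f g := ext_ev fun x hx => by
    rw [← res_ev f, ← res_ev g, SP.ev_lin hU 0 _ _ hx, SP.C_zero _ _ x hx, ev_mul,
      ev_res _ _ hx, ev_res _ _ hx]
  one_left r f := ext_ev fun x hx => by
    rw [← res_ev f, ← res_one, SP.ev_lin hU _ _ _ hx,
      SP.one_left _ (Nat.succ_pos r) _ (contDiffOn_ev f) x hx, map_zero]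
  one_right r f := ext_ev fun x hx => by
    rw [← res_ev f, ← res_one, SP.ev_lin hU _ _ _ hx,
      SP.one_right _ (Nat.succ_pos r) _ (contDiffOn_ev f) x hx, map_zero]
  assoc r f g h := ext_ev fun x hx => by
    have := SP.assoc r _ _ _ (contDiffOn_ev f) (contDiffOn_ev g) (contDiffOn_ev h) x hx
    rw [← res_ev f, ← res_ev g, ← res_ev h]
    simp only [Finset.Nat.sum_antidiagonal_eq_sum_range_succ_mk, map_sum, SP.lin_res,
      ev_res _ _ hx]
    exact this

/-- The operator `A` on smooth functions on `U` is induced by `T`. -/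
def Induces (A : Module.End ℝ (smoothAlg U)) (T : Rfn d → Rfn d) : Prop :=
  ∀ u hu, ∀ x ∈ U, ev U x (A (res u hu)) = T u x

theorem ev_ad_pow {x : Fin d → ℝ} (m : smoothAlg U) (hm : ev U x m = 0) (n : ℕ)
    (A : Module.End ℝ (smoothAlg U)) (u : smoothAlg U) :
    ev U x ((adMul (smoothAlg U) m ^ n) A u) = ev U x (A (m ^ n * u)) := by
  induction n generalizing A with
  | zero => simp
  | succ n ih =>
    rw [pow_succ, Module.End.mul_apply, ih, adMul_apply_apply, map_sub, ev_mul, hm, zero_mul,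
      sub_zero, pow_succ', mul_assoc]

theorem Induces.symb_eq (hU : IsOpen U) {A : Module.End ℝ (smoothAlg U)} {T : Rfn d → Rfn d}
    (h : Induces A T) (r : ℕ) {x : Fin d → ℝ} (hx : x ∈ U) (ξ : Fin d → ℝ) :
    symb r T (x, ξ) = ev U x ((coords hU).sym r ξ A) := by
  have hsm : ContDiff ℝ (⊤ : ℕ∞) (fun y : Fin d → ℝ => ∑ i, ξ i * (y i - x i)) := by fun_prop
  set m : smoothAlg U := (coords hU).lin ξ - algebraMap ℝ _ (∑ i, ξ i * x i) with hm
  have hev : ∀ y ∈ U, ev U y m = ∑ i, ξ i * (y i - x i) := by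
    intro y hy
    rw [hm, map_sub, Algebra.algebraMap_eq_smul_one, map_smul, ev_one hy, CoordAlg.lin_apply,
      map_sum]
    simp only [map_smul, smul_eq_mul, mul_one, mul_sub, Finset.sum_sub_distrib]
    congr 1
    exact Finset.sum_congr rfl fun i _ => by rw [coords, ev_res _ _ hy]
  have had : (coords hU).ad ξ = adMul (smoothAlg U) m := by
    rw [hm, adMul_sub_algebraMap, CoordAlg.ad_apply]
  have hpow : m ^ r = res _ (hsm.pow r).contDiffOn := ext_ev fun y hy => by
    rw [ev_res _ _ hy]
    simp only [← hev y hy]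
    induction r with
    | zero => simp [ev_one hy]
    | succ r ih => simp [pow_succ, ih]
  rw [CoordAlg.sym_apply, CoordAlg.tau_apply, LinearMap.smul_apply, map_smul, had,
    ev_ad_pow m (by simp [hev x hx]), mul_one, hpow, h _ _ x hx]
  rfl

theorem hasFDerivAt_ev_ad_pow (hU : IsOpen U) (r : ℕ) (A : Module.End ℝ (smoothAlg U))
    {x : Fin d → ℝ} (hx : x ∈ U) (ξ : Fin d → ℝ) :
    ∃ F' : ((Fin d → ℝ) × (Fin d → ℝ)) →L[ℝ] ℝ,
      HasFDerivAt (fun q : (Fin d → ℝ) × (Fin d → ℝ) =>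
        ev U q.1 (((coords hU).ad q.2 ^ r) A 1)) F' (x, ξ) ∧
      ∀ i, F' (0, Pi.single i 1) = r * ev U x
        ((coords hU).ad (Pi.single i 1) (((coords hU).ad ξ ^ (r - 1)) A) 1) := by
  induction r generalizing A with
  | zero =>
    have h1 := (differentiableAt_ev hU (A 1) hx).hasFDerivAt
    refine ⟨_, HasFDerivAt.comp (x, ξ) (f := Prod.fst) h1 hasFDerivAt_fst, fun i => by simp⟩
  | succ r ih =>
    choose F' h1 h2 using fun j => ih ((coords hU).ad (Pi.single j 1) A)
    have hfun : (fun q : (Fin d → ℝ) × (Fin d → ℝ) =>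
        ev U q.1 (((coords hU).ad q.2 ^ (r + 1)) A 1)) = fun q => ∑ j, q.2 j *
        ev U q.1 (((coords hU).ad q.2 ^ r) ((coords hU).ad (Pi.single j 1) A) 1) := by
      ext q
      rw [pow_succ, Module.End.mul_apply]
      conv_lhs => enter [2, 1, 2]; rw [CoordAlg.ad_eq_sum]
      simp [LinearMap.sum_apply]
    let L (j : Fin d) : ((Fin d → ℝ) × (Fin d → ℝ)) →L[ℝ] ℝ :=
      (ContinuousLinearMap.proj (R := ℝ) (φ := fun _ : Fin d => ℝ) j).comp
        (ContinuousLinearMap.snd ℝ _ _)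
    have hc : ∀ j, HasFDerivAt (fun q : (Fin d → ℝ) × (Fin d → ℝ) => q.2 j) (L j) (x, ξ) :=
      fun j => (L j).hasFDerivAt
    have hL : ∀ i j, L j (0, Pi.single i 1) = (Pi.single i 1 : Fin d → ℝ) j := fun _ _ => rfl
    rw [hfun]
    refine ⟨_, HasFDerivAt.fun_sum fun j _ => (hc j).mul (h1 j), fun i => ?_⟩
    simp only [sum_apply, add_apply, smul_apply, h2, Finset.sum_add_distrib, smul_eq_mul, hL,
      Nat.add_sub_cancel]
    have e1 : ∀ B : Module.End ℝ (smoothAlg U), (coords hU).ad (Pi.single i 1)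
        (((coords hU).ad ξ ^ r) B) = ((coords hU).ad ξ ^ r) ((coords hU).ad (Pi.single i 1) B) :=
      fun B => congrArg (fun T : Module.End ℝ (Module.End ℝ (smoothAlg U)) => T B)
        (((coords hU).ad_commute (Pi.single i 1) ξ).pow_right r)
    have e2 : ∑ j, ξ j * ((r : ℝ) * ev U x ((coords hU).ad (Pi.single i 1)
        (((coords hU).ad ξ ^ (r - 1)) ((coords hU).ad (Pi.single j 1) A)) 1)) =
        r * ev U x ((coords hU).ad (Pi.single i 1) (((coords hU).ad ξ ^ r) A) 1) := by
      rcases r with _ | r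
      · simp
      · rw [Nat.add_sub_cancel, pow_succ _ r, Module.End.mul_apply]
        conv_rhs => enter [2, 2, 1, 2, 2]; rw [CoordAlg.ad_eq_sum]
        simp only [LinearMap.sum_apply, LinearMap.smul_apply, map_sum, map_smul, smul_eq_mul,
          Finset.mul_sum]
        exact Finset.sum_congr rfl fun _ _ => by ring
    rw [e2, Finset.sum_eq_single i, e1]
    · simp only [Pi.single_eq_same]; push_cast; ring
    · intro j _ hj; simp [hj]
    · simp

theorem Induces.eventuallyEq (hU : IsOpen U) {A : Module.End ℝ (smoothAlg U)}
    {T : Rfn d → Rfn d} (h : Induces A T) (r : ℕ) {x : Fin d → ℝ} (hx : x ∈ U)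
    (ξ : Fin d → ℝ) : symb r T =ᶠ[nhds (x, ξ)] fun q => ev U q.1 ((coords hU).sym r q.2 A) := by
  have : U ×ˢ (Set.univ : Set (Fin d → ℝ)) ∈ nhds (x, ξ) :=
    (hU.prod isOpen_univ).mem_nhds ⟨hx, trivial⟩
  exact Filter.eventuallyEq_of_mem this fun q hq => h.symb_eq hU r hq.1 q.2

theorem Induces.fderiv_symb (hU : IsOpen U) {A : Module.End ℝ (smoothAlg U)}
    {T : Rfn d → Rfn d} (h : Induces A T) (r : ℕ) {x : Fin d → ℝ} (hx : x ∈ U)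
    (ξ : Fin d → ℝ) (i : Fin d) :
    fderiv ℝ (symb r T) (x, ξ) (0, Pi.single i 1) = ev U x ((coords hU).dsym r ξ i A) ∧
    fderiv ℝ (symb r T) (x, ξ) (Pi.single i 1, 0) =
      ev U x ((coords hU).der i ((coords hU).sym r ξ A)) := by
  obtain ⟨F', h1, h2⟩ := hasFDerivAt_ev_ad_pow hU r A hx ξ
  have h3 : HasFDerivAt (fun q : (Fin d → ℝ) × (Fin d → ℝ) =>
      ev U q.1 ((coords hU).sym r q.2 A)) ((r.factorial : ℝ)⁻¹ • F') (x, ξ) := by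
    refine (h1.const_smul (r.factorial : ℝ)⁻¹).congr_of_eventuallyEq (.of_forall fun q => ?_)
    simp [CoordAlg.sym_apply, CoordAlg.tau_apply]
  rw [(h.eventuallyEq hU r hx ξ).fderiv_eq]
  constructor
  · rw [h3.fderiv, smul_apply, h2 i]
    simp [CoordAlg.dsym, mul_assoc]
  · have h4 := h3.comp x (f := fun y => (y, ξ)) (hasFDerivAt_prodMk_left x ξ)
    have h5 : ev U x ((coords hU).der i ((coords hU).sym r ξ A)) =
        fderiv ℝ (fun y => ev U y ((coords hU).sym r ξ A)) x (Pi.single i 1) :=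
      ev_partialDer hU i _ hx
    rw [h5, h3.fderiv]
    exact (congrArg (fun T => T (Pi.single i 1)) h4.fderiv).symm.trans rfl |>.trans rfl

theorem Induces.pbT_eq (hU : IsOpen U) {A B : Module.End ℝ (smoothAlg U)}
    {T V : Rfn d → Rfn d} (hA : Induces A T) (hB : Induces B V) (r s : ℕ) {x : Fin d → ℝ}
    (hx : x ∈ U) (ξ : Fin d → ℝ) :
    pbT (symb r T) (symb s V) (x, ξ) = ev U x ((coords hU).pb r s ξ A B) := by
  simp only [pbT, CoordAlg.pb, map_sum, map_sub, ev_mul]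
  refine Finset.sum_congr rfl fun i _ => ?_
  rw [(hA.fderiv_symb hU r hx ξ i).1, (hA.fderiv_symb hU r hx ξ i).2,
    (hB.fderiv_symb hU s hx ξ i).1, (hB.fderiv_symb hU s hx ξ i).2]

theorem NatStar.induces_left (SP : NatStar d U π₀) (hU : IsOpen U) (r : ℕ) {f : Rfn d}
    (hf : ContDiffOn ℝ (⊤ : ℕ∞) f U) :
    Induces ((SP.toStar hU).c r (res f hf)) fun u => SP.C r f u :=
  fun _ hu _ hx => SP.ev_lin hU r hf hu hx

theorem NatStar.induces_right (SP : NatStar d U π₀) (hU : IsOpen U) (r : ℕ) {f : Rfn d}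
    (hf : ContDiffOn ℝ (⊤ : ℕ∞) f U) :
    Induces ((SP.toStar hU).opp.c r (res f hf)) fun u => SP.C r u f :=
  fun _ hu _ hx => SP.ev_lin hU r hu hf hx

theorem Induces.sub {A B : Module.End ℝ (smoothAlg U)} {T V : Rfn d → Rfn d}
    (hA : Induces A T) (hB : Induces B V) : Induces (A - B) fun u => T u - V u :=
  fun u hu x hx => by
    rw [LinearMap.sub_apply, map_sub, hA u hu x hx, hB u hu x hx]; rfl

theorem Induces.symb_zero (hU : IsOpen U) {A : Module.End ℝ (smoothAlg U)}
    {T : Rfn d → Rfn d} (h : Induces A T) (hA : A 1 = 0) (r : ℕ) {x : Fin d → ℝ} (hx : x ∈ U) :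
    symb r T (x, 0) = 0 := by
  rw [h.symb_eq hU r hx, CoordAlg.sym_apply, CoordAlg.tau_apply]
  rcases r with _ | r
  · simp [hA]
  · have h0 : (coords hU).ad 0 = 0 := LinearMap.map_zero _
    rw [h0, zero_pow (Nat.succ_ne_zero r)]
    simp

theorem mulSer_apply (hU : IsOpen U) {A B : ℕ → Module.End ℝ (smoothAlg U)}
    {T V : ℕ → Rfn d → Rfn d} (hA : ∀ r, Induces (A r) (T r)) (hB : ∀ r, Induces (B r) (V r))
    (r : ℕ) {x : Fin d → ℝ} (hx : x ∈ U) (ξ : Fin d → ℝ) :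
    mulSer (fun r => symb r (T r)) (fun r => symb r (V r)) r (x, ξ) =
      ev U x (∑ p ∈ Finset.HasAntidiagonal.antidiagonal r,
        (coords hU).sym p.1 ξ (A p.1) * (coords hU).sym p.2 ξ (B p.2)) := by
  rw [Finset.Nat.sum_antidiagonal_eq_sum_range_succ_mk, map_sum]
  exact Finset.sum_congr rfl fun i _ => (congrArg₂ (HMul.hMul : ℝ → ℝ → ℝ)
    ((hA _).symb_eq hU _ hx ξ) ((hB _).symb_eq hU _ hx ξ)).trans (ev_mul _ _ _).symm

theorem pbTSer_apply (hU : IsOpen U) {A B : ℕ → Module.End ℝ (smoothAlg U)}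
    {T V : ℕ → Rfn d → Rfn d} (hA : ∀ r, Induces (A r) (T r)) (hB : ∀ r, Induces (B r) (V r))
    (r : ℕ) {x : Fin d → ℝ} (hx : x ∈ U) (ξ : Fin d → ℝ) :
    pbTSer (fun r => symb r (T r)) (fun r => symb r (V r)) r (x, ξ) =
      ev U x (∑ p ∈ Finset.HasAntidiagonal.antidiagonal (r + 1),
        (coords hU).pb p.1 p.2 ξ (A p.1) (B p.2)) := by
  rw [Finset.Nat.sum_antidiagonal_eq_sum_range_succ_mk, map_sum]
  exact Finset.sum_congr rfl fun i _ => (hA _).pbT_eq hU (hB _) _ _ hx ξ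

theorem NatStar.sym_left_eq {SP SP' : NatStar d U π₀} (hU : IsOpen U)
    (hσ : ∀ f : Rfn d, ContDiffOn ℝ (⊤ : ℕ∞) f U → EqSer U (S0 SP f) (S0 SP' f))
    (f : smoothAlg U) (r : ℕ) (ξ : Fin d → ℝ) :
    (coords hU).sym r ξ ((SP.toStar hU).c r f) = (coords hU).sym r ξ ((SP'.toStar hU).c r f) :=
  ext_ev fun x hx => by
    rw [← res_ev f, ← (SP.induces_left hU r _).symb_eq hU r hx,
      ← (SP'.induces_left hU r _).symb_eq hU r hx]
    exact hσ _ (contDiffOn_ev f) r x hx ξ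

theorem NatStar.sym_right_eq {SP SP' : NatStar d U π₀} (hU : IsOpen U)
    (hσ : ∀ f : Rfn d, ContDiffOn ℝ (⊤ : ℕ∞) f U → EqSer U (T0 SP f) (T0 SP' f))
    (f : smoothAlg U) (r : ℕ) (ξ : Fin d → ℝ) :
    (coords hU).sym r ξ ((SP.toStar hU).opp.c r f) =
      (coords hU).sym r ξ ((SP'.toStar hU).opp.c r f) :=
  ext_ev fun x hx => by
    rw [← res_ev f, ← (SP.induces_right hU r _).symb_eq hU r hx,
      ← (SP'.induces_right hU r _).symb_eq hU r hx]
    exact hσ _ (contDiffOn_ev f) r x hx ξ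

theorem contDiffOn_pbr (hU : IsOpen U) (hπ : IsPoissonOn U π₀) {f g : Rfn d}
    (hf : ContDiffOn ℝ (⊤ : ℕ∞) f U) (hg : ContDiffOn ℝ (⊤ : ℕ∞) g U) :
    ContDiffOn ℝ (⊤ : ℕ∞) (pbr π₀ f g) U :=
  ContDiffOn.sum fun i _ => ContDiffOn.sum fun j _ =>
    ((hπ.1 i j).mul (contDiffOn_pderi hU i hf)).mul (contDiffOn_pderi hU j hg)

theorem contDiffOn_brOne (hU : IsOpen U) (SP SP' : NatStar d U π₀) {f g : Rfn d}
    (hf : ContDiffOn ℝ (⊤ : ℕ∞) f U) (hg : ContDiffOn ℝ (⊤ : ℕ∞) g U) :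
    ContDiffOn ℝ (⊤ : ℕ∞) (brOne SP SP' f g) U :=
  ((SP.contDiffOn_C hU 2 hf hg).sub (SP.contDiffOn_C hU 2 hg hf)).sub
    ((SP'.contDiffOn_C hU 2 hf hg).sub (SP'.contDiffOn_C hU 2 hg hf))

theorem res_mul {f g : Rfn d} (hf : ContDiffOn ℝ (⊤ : ℕ∞) f U) (hg : ContDiffOn ℝ (⊤ : ℕ∞) g U) :
    res (fun y => f y * g y) (hf.mul hg) = res f hf * res g hg :=
  ext_ev fun _ hx => by rw [ev_mul, ev_res _ _ hx, ev_res _ _ hx, ev_res _ _ hx]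

theorem res_pbr (hU : IsOpen U) (hπ : IsPoissonOn U π₀) (SP : NatStar d U π₀) {f g : Rfn d}
    (hf : ContDiffOn ℝ (⊤ : ℕ∞) f U) (hg : ContDiffOn ℝ (⊤ : ℕ∞) g U) :
    res (pbr π₀ f g) (contDiffOn_pbr hU hπ hf hg) =
      (SP.toStar hU).c 1 (res f hf) (res g hg) - (SP.toStar hU).c 1 (res g hg) (res f hf) :=
  ext_ev fun x hx => by
    rw [map_sub, ev_res _ _ hx, ← SP.C_one_skew f g hf hg x hx]
    exact (congrArg₂ _ (SP.ev_lin hU 1 hf hg hx) (SP.ev_lin hU 1 hg hf hx)).symm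

theorem res_brOne (hU : IsOpen U) (SP SP' : NatStar d U π₀) {f g : Rfn d}
    (hf : ContDiffOn ℝ (⊤ : ℕ∞) f U) (hg : ContDiffOn ℝ (⊤ : ℕ∞) g U) :
    res (brOne SP SP' f g) (contDiffOn_brOne hU SP SP' hf hg) =
      ((SP.toStar hU).c 2 (res f hf) (res g hg) - (SP.toStar hU).c 2 (res g hg) (res f hf)) -
      ((SP'.toStar hU).c 2 (res f hf) (res g hg) - (SP'.toStar hU).c 2 (res g hg) (res f hf)) :=
  ext_ev fun x hx => by
    rw [ev_res _ _ hx, map_sub, map_sub, map_sub]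
    exact (congrArg₂ _ (congrArg₂ _ (SP.ev_lin hU 2 hf hg hx) (SP.ev_lin hU 2 hg hf hx))
      (congrArg₂ _ (SP'.ev_lin hU 2 hf hg hx) (SP'.ev_lin hU 2 hg hf hx))).symm

end Concrete

/-- For two natural star products on `(U, π₀)` with the same formal
symplectic groupoid (`σ(L_f) = σ(L̃_f)`, `σ(R_f) = σ(R̃_f)`), the maps
`S₀, T₀, S₁, T₁` satisfy the unit, product and bracket axioms (2), (3), (4) of an
infinitesimal deformation of a formal symplectic groupoid. -/
theorem deformation_groupoid_axioms {d : ℕ} (U : Set (Fin d → ℝ)) (hU : IsOpen U)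
    (π₀ : Fin d → Fin d → Rfn d) (hπ : IsPoissonOn U π₀)
    (SP SP' : NatStar d U π₀)
    (hσL : ∀ f : Rfn d, ContDiffOn ℝ (⊤ : ℕ∞) f U → EqSer U (S0 SP f) (S0 SP' f))
    (hσR : ∀ f : Rfn d, ContDiffOn ℝ (⊤ : ℕ∞) f U → EqSer U (T0 SP f) (T0 SP' f)) :
    ∀ f g : Rfn d, ContDiffOn ℝ (⊤ : ℕ∞) f U → ContDiffOn ℝ (⊤ : ℕ∞) g U →
      -- (i) unit axioms: E(S₁f) = 0 and E(T₁f) = 0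
      ((∀ r : ℕ, ∀ x ∈ U, S1 SP SP' f r (x, 0) = 0) ∧
       (∀ r : ℕ, ∀ x ∈ U, T1 SP SP' f r (x, 0) = 0)) ∧
      -- (ii) product axioms
      (EqSer U (S1 SP SP' (fun y => f y * g y))
          (mulSer (S0 SP f) (S1 SP SP' g) + mulSer (S1 SP SP' f) (S0 SP g)) ∧
       EqSer U (T1 SP SP' (fun y => f y * g y))
          (mulSer (T0 SP f) (T1 SP SP' g) + mulSer (T1 SP SP' f) (T0 SP g))) ∧
      -- (iii) bracket axioms
      (EqSer U (S1 SP SP' (pbr π₀ f g) + S0 SP (brOne SP SP' f g))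
          (pbTSer (S0 SP f) (S1 SP SP' g) + pbTSer (S1 SP SP' f) (S0 SP g)) ∧
       EqSer U (T1 SP SP' (pbr π₀ f g) + T0 SP (brOne SP SP' f g))
          (-(pbTSer (T0 SP f) (T1 SP SP' g)) + -(pbTSer (T1 SP SP' f) (T0 SP g))) ∧
       EqSer U (pbTSer (S0 SP f) (T1 SP SP' g) + pbTSer (S1 SP SP' f) (T0 SP g)) 0) := by
  intro f g hf hg
  have add_congr {a b a' b' : ℝ} (h : a = a') (h' : b = b') : a + b = a' + b' :=
    congrArg₂ _ h h'
  have hL := NatStar.sym_left_eq (SP := SP) (SP' := SP') hU hσL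
  have hR := NatStar.sym_right_eq (SP := SP) (SP' := SP') hU hσR
  have iL (u) (hu : ContDiffOn ℝ (⊤ : ℕ∞) u U) (r : ℕ) := SP.induces_left hU r hu
  have iR (u) (hu : ContDiffOn ℝ (⊤ : ℕ∞) u U) (r : ℕ) := SP.induces_right hU r hu
  have jL (u) (hu : ContDiffOn ℝ (⊤ : ℕ∞) u U) (r : ℕ) :=
    (SP.induces_left hU (r + 1) hu).sub (SP'.induces_left hU (r + 1) hu)
  have jR (u) (hu : ContDiffOn ℝ (⊤ : ℕ∞) u U) (r : ℕ) :=
    (SP.induces_right hU (r + 1) hu).sub (SP'.induces_right hU (r + 1) hu)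
  have hp := contDiffOn_pbr hU hπ hf hg
  have hb := contDiffOn_brOne hU SP SP' hf hg
  refine ⟨⟨fun r x hx => ?_, fun r x hx => ?_⟩, ⟨fun r x hx ξ => ?_, fun r x hx ξ => ?_⟩,
    fun r x hx ξ => ?_, fun r x hx ξ => ?_, fun r x hx ξ => ?_⟩
  · exact (jL f hf r).symb_zero hU (CoordAlg.Star.diff_apply_one (SP.toStar hU)
      (SP'.toStar hU) r _) r hx
  · exact (jR f hf r).symb_zero hU (CoordAlg.Star.diff_apply_one (SP.toStar hU).opp
      (SP'.toStar hU).opp r _) r hx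
  · refine ((jL _ (hf.mul hg) r).symb_eq hU r hx ξ).trans ?_
    refine Eq.trans ?_ (add_congr (mulSer_apply hU (iL f hf) (jL g hg) r hx ξ)
      (mulSer_apply hU (jL f hf) (iL g hg) r hx ξ)).symm
    rw [res_mul hf hg, CoordAlg.Star.sym_diff_mul hL, Finset.sum_add_distrib, map_add]
  · refine ((jR _ (hf.mul hg) r).symb_eq hU r hx ξ).trans ?_
    refine Eq.trans ?_ (add_congr (mulSer_apply hU (iR f hf) (jR g hg) r hx ξ)
      (mulSer_apply hU (jR f hf) (iR g hg) r hx ξ)).symm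
    rw [res_mul hf hg, CoordAlg.Star.sym_diff_mul hR, Finset.sum_add_distrib, map_add]
  · refine (add_congr ((jL _ hp r).symb_eq hU r hx ξ) ((iL _ hb r).symb_eq hU r hx ξ)).trans ?_
    refine Eq.trans ?_ (add_congr (pbTSer_apply hU (iL f hf) (jL g hg) r hx ξ)
      (pbTSer_apply hU (jL f hf) (iL g hg) r hx ξ)).symm
    rw [res_pbr hU hπ SP hf hg, res_brOne hU SP SP' hf hg, ← map_add (ev U x), ← map_add (ev U x),
      ← Finset.sum_add_distrib, ← CoordAlg.Star.sym_diff_commutator hL]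
  · refine (add_congr ((jR _ hp r).symb_eq hU r hx ξ) ((iR _ hb r).symb_eq hU r hx ξ)).trans ?_
    refine Eq.trans ?_ (add_congr
      (congrArg (Neg.neg : ℝ → ℝ) (pbTSer_apply hU (iR f hf) (jR g hg) r hx ξ))
      (congrArg (Neg.neg : ℝ → ℝ) (pbTSer_apply hU (jR f hf) (iR g hg) r hx ξ))).symm
    have key := CoordAlg.Star.sym_diff_commutator hR (res f hf) (res g hg) r ξ
    have e1 : res (pbr π₀ f g) hp =
        -((SP.toStar hU).opp.c 1 (res f hf) (res g hg) -
          (SP.toStar hU).opp.c 1 (res g hg) (res f hf)) :=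
      (res_pbr hU hπ SP hf hg).trans (neg_sub _ _).symm
    have e2 : res (brOne SP SP' f g) hb =
        -(((SP.toStar hU).opp.c 2 (res f hf) (res g hg) -
            (SP.toStar hU).opp.c 2 (res g hg) (res f hf)) -
          ((SP'.toStar hU).opp.c 2 (res f hf) (res g hg) -
            (SP'.toStar hU).opp.c 2 (res g hg) (res f hf))) := by
      refine (res_brOne hU SP SP' hf hg).trans ?_
      change ((SP.toStar hU).opp.c 2 (res g hg) (res f hf) -
            (SP.toStar hU).opp.c 2 (res f hf) (res g hg)) -
          ((SP'.toStar hU).opp.c 2 (res g hg) (res f hf) -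
            (SP'.toStar hU).opp.c 2 (res f hf) (res g hg)) = _
      abel
    rw [Finset.sum_add_distrib] at key
    rw [e1, e2, ← neg_add, ← map_add (ev U x), ← map_add (ev U x), ← key, ← map_neg (ev U x),
      CoordAlg.Star.sym_diff_neg]
  · refine (add_congr (pbTSer_apply hU (iL f hf) (jR g hg) r hx ξ)
      (pbTSer_apply hU (jL f hf) (iR g hg) r hx ξ)).trans ?_
    have key := CoordAlg.Star.sym_mixed hL hR (res f hf) (res g hg) r ξ
    rw [Finset.sum_add_distrib] at key
    exact (map_add (ev U x) _ _).symm.trans ((congrArg _ key).trans (map_zero _))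

end
end
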